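/- arXiv:0911.3787 — 3 statements merged into one kernel-verified Lean document; each statement's English description precedes it below -/
import Mathlib

section
/- Assume the family (β_u)_{u∈[0,1]} has the property that whenever E[β_u(U)·γ_z^⊥(Z̃)·γ_y^⊥(Ỹ)] = 0 for all (u,y,z) ∈ [0,1]³, it follows that E[γ_z^⊥(Z̃)·γ_y^⊥(Ỹ) | σ(U)] = 0 almost surely for every (y,z) ∈ [0,1]². Then the following are equivalent: (i) for every y, z ∈ ℝ, P(Y ≤ y, Z ≤ z | σ(U)) = P(Y ≤ y | σ(U))·P(Z ≤ z | σ(U)) almost surely (conditional independence of Y and Z given U); (ii) E[β_u(U)·γ_z^⊥(Z̃)·γ_y^⊥(Ỹ)] = 0 for all (u,y,z) ∈ [0,1]³. (Lemma 1 of the paper.) -/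
open MeasureTheory ProbabilityTheory

/-- `γ_z^⊥(t) = z·exp(t·z) − (exp(z) − 1)`. -/
noncomputable def gammaPerp (z t : ℝ) : ℝ := z * Real.exp (t * z) - (Real.exp z - 1)

section ExponentialMoments

open Set Filter Topology

lemma integral_gammaPerp_unitInterval (z : ℝ) :
    ∫ t, gammaPerp z t ∂(volume.restrict (Icc (0 : ℝ) 1)) = 0 := by
  rw [integral_Icc_eq_integral_Ioc, ← intervalIntegral.integral_of_le zero_le_one]
  have h : ∀ x ∈ uIcc (0 : ℝ) 1,
      HasDerivAt (fun t => Real.exp (t * z) - (Real.exp z - 1) * t) (gammaPerp z x) x := by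
    intro x _
    have h1 : HasDerivAt (fun t : ℝ => Real.exp (t * z)) (Real.exp (x * z) * (1 * z)) x :=
      ((hasDerivAt_id x).mul_const z).exp
    refine (h1.sub ((hasDerivAt_id x).const_mul (Real.exp z - 1))).congr_deriv ?_
    simp only [gammaPerp]
    ring
  rw [intervalIntegral.integral_eq_sub_of_hasDerivAt h]
  · simp
  · exact Continuous.intervalIntegrable (by unfold gammaPerp; fun_prop) _ _

lemma integrableExpSet_id_eq_univ {μ : Measure ℝ} [IsFiniteMeasure μ]
    (hμ : ∀ᵐ x ∂μ, x ∈ Icc (0 : ℝ) 1) : integrableExpSet id μ = univ := by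
  refine eq_univ_of_forall fun t => ?_
  refine Integrable.of_bound (C := Real.exp |t|) (by fun_prop) ?_
  filter_upwards [hμ] with x hx
  rw [Real.norm_eq_abs, Real.abs_exp, Real.exp_le_exp]
  calc t * x ≤ |t * x| := le_abs_self _
    _ = |t| * x := by rw [abs_mul, abs_of_nonneg hx.1]
    _ ≤ |t| := mul_le_of_le_one_right (abs_nonneg _) hx.2

/-- Finite measures on `[0, 1]` are determined by their moment generating functions
on `(0, 1)`. -/
lemma ext_of_integral_exp_eq {μ ν : Measure ℝ} [IsFiniteMeasure μ] [IsFiniteMeasure ν]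
    (hμ : ∀ᵐ x ∂μ, x ∈ Icc (0 : ℝ) 1) (hν : ∀ᵐ x ∂ν, x ∈ Icc (0 : ℝ) 1)
    (h : ∀ t ∈ Ioo (0 : ℝ) 1, ∫ x, Real.exp (t * x) ∂μ = ∫ x, Real.exp (t * x) ∂ν) : μ = ν := by
  apply Measure.ext_of_complexMGF_id_eq
  have hanalytic : ∀ {ρ : Measure ℝ} [IsFiniteMeasure ρ], (∀ᵐ x ∂ρ, x ∈ Icc (0 : ℝ) 1) →
      AnalyticOnNhd ℂ (complexMGF id ρ) univ := by
    intro ρ _ hρ z _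
    exact analyticAt_complexMGF (by simp [integrableExpSet_id_eq_univ hρ])
  refine (hanalytic hμ).eq_of_frequently_eq (z₀ := ((1 / 2 : ℝ) : ℂ)) (hanalytic hν) ?_
  have htend : Tendsto ((↑) : ℝ → ℂ) (𝓝[≠] (1 / 2 : ℝ)) (𝓝[≠] ((1 / 2 : ℝ) : ℂ)) :=
    Complex.continuous_ofReal.continuousWithinAt.tendsto_nhdsWithin
      fun x hx => Complex.ofReal_injective.ne hx
  refine htend.frequently (Eventually.frequently ?_)
  have hmem : Ioo (0 : ℝ) 1 ∈ 𝓝[≠] (1 / 2 : ℝ) :=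
    mem_nhdsWithin_of_mem_nhds (Ioo_mem_nhds (by norm_num) (by norm_num))
  filter_upwards [hmem] with t ht
  rw [complexMGF_ofReal, complexMGF_ofReal]
  exact congrArg _ (h t ht)

lemma integrable_exp_mul_of_mem_Icc {α : Type*} [MeasurableSpace α] {μ : Measure α}
    [IsFiniteMeasure μ] {f : α → ℝ} (hf : Measurable f) (h : ∀ᵐ x ∂μ, f x ∈ Icc (0 : ℝ) 1)
    (s : ℝ) : Integrable (fun x => Real.exp (s * f x)) μ := by
  have h' : ∀ᵐ x ∂(μ.map f), x ∈ Icc (0 : ℝ) 1 :=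
    (ae_map_iff hf.aemeasurable measurableSet_Icc).2 h
  have : s ∈ integrableExpSet id (μ.map f) := by simp [integrableExpSet_id_eq_univ h']
  exact (integrable_map_measure (by fun_prop) hf.aemeasurable).1 this

/-- Finite measures on `[0, 1]²` are determined by their moment generating functions
on `(0, 1)²`. -/
lemma ext_prod_of_integral_exp_eq {μ ν : Measure (ℝ × ℝ)} [IsFiniteMeasure μ] [IsFiniteMeasure ν]
    (hμ : ∀ᵐ p ∂μ, p.1 ∈ Icc (0 : ℝ) 1 ∧ p.2 ∈ Icc (0 : ℝ) 1)
    (hν : ∀ᵐ p ∂ν, p.1 ∈ Icc (0 : ℝ) 1 ∧ p.2 ∈ Icc (0 : ℝ) 1)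
    (h : ∀ s ∈ Ioo (0 : ℝ) 1, ∀ t ∈ Ioo (0 : ℝ) 1,
      ∫ p, Real.exp (s * p.1) * Real.exp (t * p.2) ∂μ =
        ∫ p, Real.exp (s * p.1) * Real.exp (t * p.2) ∂ν) : μ = ν := by
  have hsnd : ∀ {ρ : Measure (ℝ × ℝ)} [IsFiniteMeasure ρ],
      (∀ᵐ p ∂ρ, p.1 ∈ Icc (0 : ℝ) 1 ∧ p.2 ∈ Icc (0 : ℝ) 1) → ∀ s,
      Integrable (fun p : ℝ × ℝ => Real.exp (s * p.1)) ρ :=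
    fun hρ s => integrable_exp_mul_of_mem_Icc measurable_fst (hρ.mono fun _ hp => hp.1) s
  have hset : ∀ s ∈ Ioo (0 : ℝ) 1, ∀ B, MeasurableSet B →
      ∫ p in Prod.snd ⁻¹' B, Real.exp (s * p.1) ∂μ =
        ∫ p in Prod.snd ⁻¹' B, Real.exp (s * p.1) ∂ν := by
    intro s hs B hB
    have key : ∀ {ρ : Measure (ℝ × ℝ)} [IsFiniteMeasure ρ],
        (∀ᵐ p ∂ρ, p.1 ∈ Icc (0 : ℝ) 1 ∧ p.2 ∈ Icc (0 : ℝ) 1) →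
        IsFiniteMeasure ((ρ.withDensity fun p => ENNReal.ofReal (Real.exp (s * p.1))).map
          Prod.snd) ∧
        (∀ᵐ x ∂((ρ.withDensity fun p => ENNReal.ofReal (Real.exp (s * p.1))).map Prod.snd),
          x ∈ Icc (0 : ℝ) 1) ∧
        (∀ t, ∫ x, Real.exp (t * x)
          ∂((ρ.withDensity fun p => ENNReal.ofReal (Real.exp (s * p.1))).map Prod.snd) =
          ∫ p, Real.exp (s * p.1) * Real.exp (t * p.2) ∂ρ) ∧
        ((ρ.withDensity fun p => ENNReal.ofReal (Real.exp (s * p.1))).map Prod.snd) B =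
          ENNReal.ofReal (∫ p in Prod.snd ⁻¹' B, Real.exp (s * p.1) ∂ρ) := by
      intro ρ _ hρ
      have : IsFiniteMeasure (ρ.withDensity fun p => ENNReal.ofReal (Real.exp (s * p.1))) :=
        isFiniteMeasure_withDensity_ofReal (hsnd hρ s).2
      refine ⟨inferInstance, ?_, fun t => ?_, ?_⟩
      · refine (ae_map_iff measurable_snd.aemeasurable measurableSet_Icc).2 ?_
        exact (withDensity_absolutelyContinuous _ _).ae_le (hρ.mono fun _ hp => hp.2)
      · rw [integral_map measurable_snd.aemeasurable (by fun_prop),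
          integral_withDensity_eq_integral_toReal_smul (by fun_prop) (by simp)]
        simp [Real.exp_nonneg]
      · rw [Measure.map_apply measurable_snd hB, withDensity_apply _ (measurable_snd hB),
          ofReal_integral_eq_lintegral_ofReal (hsnd hρ s).integrableOn
            (ae_of_all _ fun _ => Real.exp_nonneg _)]
    obtain ⟨_, hμ1, hμ2, hμ3⟩ := key hμ
    obtain ⟨_, hν1, hν2, hν3⟩ := key hν
    have heq := ext_of_integral_exp_eq hμ1 hν1 fun t ht => by
      rw [hμ2, hν2]; exact h s hs t ht
    have hB' := hμ3.symm.trans ((congrArg (fun m => m B) heq).trans hν3)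
    refine (ENNReal.ofReal_eq_ofReal_iff ?_ ?_).1 hB' <;>
      exact integral_nonneg fun _ => Real.exp_nonneg _
  refine Measure.ext_prod fun {A B} hA hB => ?_
  have hmap : ∀ {ρ : Measure (ℝ × ℝ)},
      (∀ᵐ p ∂ρ, p.1 ∈ Icc (0 : ℝ) 1 ∧ p.2 ∈ Icc (0 : ℝ) 1) →
      ∀ᵐ x ∂((ρ.restrict (Prod.snd ⁻¹' B)).map Prod.fst), x ∈ Icc (0 : ℝ) 1 := by
    intro ρ hρ
    refine (ae_map_iff measurable_fst.aemeasurable measurableSet_Icc).2 ?_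
    exact ae_restrict_of_ae (hρ.mono fun _ hp => hp.1)
  have heq := ext_of_integral_exp_eq (hmap hμ) (hmap hν) fun s hs => by
    rw [integral_map measurable_fst.aemeasurable (by fun_prop),
      integral_map measurable_fst.aemeasurable (by fun_prop)]
    exact hset s hs B hB
  have hA' := congrArg (fun m => m A) heq
  simpa only [Measure.map_apply measurable_fst hA, Measure.restrict_apply (measurable_fst hA),
    ← Set.prod_eq] using hA'

end ExponentialMoments

section ConditionalCDF

open Set Filter Topology

variable {α : Type*} [MeasurableSpace α]

/-- The Markov kernel whose value at `a` is the measure with distribution function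
`condCDF ρ a`. -/
noncomputable def condCDFKernel (ρ : Measure (α × ℝ)) : Kernel α ℝ where
  toFun a := (condCDF ρ a).measure
  measurable' := measurable_measure_condCDF ρ

lemma condCDFKernel_apply (ρ : Measure (α × ℝ)) (a : α) :
    condCDFKernel ρ a = (condCDF ρ a).measure := rfl

instance (ρ : Measure (α × ℝ)) : IsMarkovKernel (condCDFKernel ρ) :=
  ⟨fun a => instIsProbabilityMeasureCondCDF ρ a⟩

lemma fst_compProd_condCDFKernel (ρ : Measure (α × ℝ)) [IsFiniteMeasure ρ] :
    ρ.fst ⊗ₘ condCDFKernel ρ = ρ := by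
  ext s hs
  rw [Measure.compProd_apply hs]
  exact lintegral_toKernel_mem (isCondKernelCDF_condCDF ρ) () hs

lemma measurable_condCDF_prod (ρ : Measure (α × ℝ)) :
    Measurable fun p : α × ℝ => condCDF ρ p.1 p.2 := by
  have h : Measurable fun p : α × ℝ =>
      (condCDFKernel ρ).comap Prod.fst measurable_fst p
        (Prod.mk p ⁻¹' {q : (α × ℝ) × ℝ | q.2 ≤ q.1.2}) :=
    Kernel.measurable_kernel_prodMk_left
      (measurableSet_le measurable_snd (measurable_snd.comp measurable_fst))
  convert h.ennreal_toReal using 2 with p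
  have : Prod.mk p ⁻¹' {q : (α × ℝ) × ℝ | q.2 ≤ q.1.2} = Iic p.2 := rfl
  rw [this, Kernel.comap_apply, condCDFKernel_apply, measure_condCDF_Iic,
    ENNReal.toReal_ofReal (condCDF_nonneg ρ _ _)]

lemma measurable_condCDF_right (ρ : Measure (α × ℝ)) (a : α) : Measurable (condCDF ρ a) :=
  (condCDF ρ a).mono.measurable

lemma absolutelyContinuous_fst_prod {ρ : Measure (α × ℝ)} [IsFiniteMeasure ρ] {μ : Measure α}
    {ν : Measure ℝ} [SFinite μ] [IsFiniteMeasure ν] (h : ρ ≪ μ.prod ν) : ρ ≪ ρ.fst.prod ν := by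
  have h' : ρ.fst ⊗ₘ condCDFKernel ρ ≪ μ ⊗ₘ Kernel.const α ν := by
    rwa [fst_compProd_condCDFKernel, Measure.compProd_const]
  have h'' := Measure.AbsolutelyContinuous.compProd_right h'.kernel_of_compProd
  rwa [fst_compProd_condCDFKernel, Measure.compProd_const] at h''

lemma ae_nullSingletonClass_condCDF {ρ : Measure (α × ℝ)} [IsFiniteMeasure ρ]
    {ν : Measure ℝ} [IsFiniteMeasure ν] [NullSingletonClass ν] (h : ρ ≪ ρ.fst.prod ν) :
    ∀ᵐ a ∂ρ.fst, NullSingletonClass (condCDF ρ a).measure := by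
  have h' : ρ.fst ⊗ₘ condCDFKernel ρ ≪ ρ.fst ⊗ₘ Kernel.const α ν := by
    rwa [fst_compProd_condCDFKernel, Measure.compProd_const]
  filter_upwards [h'.kernel_of_compProd] with a ha
  exact ⟨fun x => ha (measure_singleton (μ := ν) x)⟩

lemma continuous_condCDF {ρ : Measure (α × ℝ)} {a : α}
    [NullSingletonClass (condCDF ρ a).measure] : Continuous (condCDF ρ a) := by
  refine continuous_iff_continuousAt.2 fun x => ?_
  rw [(condCDF ρ a).mono.continuousAt_iff_leftLim_eq_rightLim, (condCDF ρ a).rightLim_eq]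
  have h := (condCDF ρ a).measure_singleton x
  rw [measure_singleton, eq_comm, ENNReal.ofReal_eq_zero] at h
  exact le_antisymm ((condCDF ρ a).mono.leftLim_le le_rfl) (by linarith)

lemma volume_restrict_Icc_Iic {t : ℝ} (ht : t ∈ Icc (0 : ℝ) 1) :
    volume.restrict (Icc (0 : ℝ) 1) (Iic t) = ENNReal.ofReal t := by
  have h : Iic t ∩ Icc (0 : ℝ) 1 = Icc 0 t := by
    ext x
    simp only [mem_inter_iff, mem_Iic, mem_Icc]
    exact ⟨fun h => ⟨h.2.1, h.1⟩, fun h => ⟨h.2, h.1, h.2.trans ht.2⟩⟩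
  rw [Measure.restrict_apply measurableSet_Iic, h, Real.volume_Icc, sub_zero]

/-- The probability integral transform for a conditional law without atoms. -/
lemma map_condCDF_eq_volume {ρ : Measure (α × ℝ)} {a : α}
    [NullSingletonClass (condCDF ρ a).measure] :
    (condCDF ρ a).measure.map (condCDF ρ a) = volume.restrict (Icc (0 : ℝ) 1) := by
  set F := condCDF ρ a with hF
  have hcont : Continuous F := continuous_condCDF
  have hex : ∀ t ∈ Ioo (0 : ℝ) 1, ∃ y, F y = t := fun t ht =>
    mem_range_of_exists_le_of_exists_ge hcont
      ((tendsto_condCDF_atBot ρ a).eventually_le_const ht.1).exists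
      ((tendsto_condCDF_atTop ρ a).eventually_const_le ht.2).exists
  have hmeas : Measurable F := hcont.measurable
  have := Measure.isProbabilityMeasure_map (μ := F.measure) hmeas.aemeasurable
  refine Measure.ext_of_Iic _ _ fun t => ?_
  rw [Measure.map_apply hmeas measurableSet_Iic, Measure.restrict_apply measurableSet_Iic]
  have hupper : ∀ t', t < t' → 0 < t' → t' < 1 → F.measure (F ⁻¹' Iic t) ≤ ENNReal.ofReal t' := by
    intro t' htt' h0 h1
    obtain ⟨y, hy⟩ := hex t' ⟨h0, h1⟩
    calc F.measure (F ⁻¹' Iic t) ≤ F.measure (Iic y) := by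
          refine measure_mono fun x hx => ?_
          by_contra hlt
          have hmono := F.mono (not_le.1 hlt).le
          rw [hy] at hmono
          exact absurd (hmono.trans hx) (not_le.2 htt')
      _ = ENNReal.ofReal t' := by rw [hF, measure_condCDF_Iic, ← hF, hy]
  rcases le_or_gt 1 t with h1 | h1
  · have hl : F ⁻¹' Iic t = univ := eq_univ_of_forall fun x => (condCDF_le_one ρ a x).trans h1
    have hr : Iic t ∩ Icc (0 : ℝ) 1 = Icc 0 1 :=
      inter_eq_right.2 fun x hx => hx.2.trans h1
    rw [hl, hr, hF, measure_condCDF_univ]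
    simp
  have hr : Iic t ∩ Icc (0 : ℝ) 1 = Icc 0 t := by
    ext x
    simp only [mem_inter_iff, mem_Iic, mem_Icc]
    exact ⟨fun h => ⟨h.2.1, h.1⟩, fun h => ⟨h.2, h.1, h.2.trans h1.le⟩⟩
  rw [hr, Real.volume_Icc, sub_zero]
  refine le_antisymm ?_ ?_
  · have hmax : ENNReal.ofReal t = ENNReal.ofReal (max t 0) := by simp [ENNReal.ofReal_max]
    rw [hmax]
    have htend : Tendsto ENNReal.ofReal (𝓝[>] (max t 0)) (𝓝 (ENNReal.ofReal (max t 0))) :=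
      (ENNReal.continuous_ofReal.tendsto _).mono_left nhdsWithin_le_nhds
    refine ge_of_tendsto htend ?_
    filter_upwards [Ioo_mem_nhdsGT (max_lt h1 one_pos)] with t' ht'
    exact hupper t' ((le_max_left _ _).trans_lt ht'.1) ((le_max_right _ _).trans_lt ht'.1) ht'.2
  · rcases le_or_gt t 0 with h0 | h0
    · simp [ENNReal.ofReal_of_nonpos h0]
    · obtain ⟨y, hy⟩ := hex t ⟨h0, h1⟩
      rw [← hy, hF, ← measure_condCDF_Iic, ← hF]
      exact measure_mono fun x hx => F.mono hx

lemma ae_condCDF_le_iff {ρ : Measure (α × ℝ)} {a : α} [NullSingletonClass (condCDF ρ a).measure]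
    (y : ℝ) : ∀ᵐ x ∂(condCDF ρ a).measure, condCDF ρ a x ≤ condCDF ρ a y ↔ x ≤ y := by
  have hsub : Iic y ⊆ condCDF ρ a ⁻¹' Iic (condCDF ρ a y) := fun x hx => (condCDF ρ a).mono hx
  have hle : (condCDF ρ a).measure (condCDF ρ a ⁻¹' Iic (condCDF ρ a y)) ≤
      (condCDF ρ a).measure (Iic y) := by
    rw [← Measure.map_apply (measurable_condCDF_right ρ a) measurableSet_Iic,
      map_condCDF_eq_volume, volume_restrict_Icc_Iic ⟨condCDF_nonneg ρ a y, condCDF_le_one ρ a y⟩,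
      measure_condCDF_Iic]
  have heq := ae_eq_of_subset_of_measure_ge hsub hle measurableSet_Iic.nullMeasurableSet
    (measure_ne_top _ _)
  filter_upwards [heq.mem_iff] with x hx using hx.symm

lemma ae_condCDF_le_iff_of_prod {ρ : Measure (α × ℝ)} [IsFiniteMeasure ρ]
    (hρ : ∀ᵐ a ∂ρ.fst, NullSingletonClass (condCDF ρ a).measure) (y : ℝ) :
    ∀ᵐ p ∂ρ, condCDF ρ p.1 p.2 ≤ condCDF ρ p.1 y ↔ p.2 ≤ y := by
  have hmeas : MeasurableSet {p : α × ℝ | condCDF ρ p.1 p.2 ≤ condCDF ρ p.1 y ↔ p.2 ≤ y} :=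
    (measurableSet_le (measurable_condCDF_prod ρ)
      ((measurable_condCDF ρ y).comp measurable_fst)).iff
      (measurableSet_le measurable_snd measurable_const)
  have h := Measure.ae_compProd_of_ae_ae (μ := ρ.fst) (κ := condCDFKernel ρ) hmeas
    (hρ.mono fun a ha => ae_condCDF_le_iff y)
  rwa [fst_compProd_condCDFKernel] at h

/-- The conditional probability integral transform is uniform on `[0, 1]` and independent of the
conditioning variable. -/
lemma map_condCDF_prod_eq {ρ : Measure (α × ℝ)} [IsFiniteMeasure ρ]
    (hρ : ∀ᵐ a ∂ρ.fst, NullSingletonClass (condCDF ρ a).measure) :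
    ρ.map (fun p => (p.1, condCDF ρ p.1 p.2)) = ρ.fst.prod (volume.restrict (Icc (0 : ℝ) 1)) := by
  have hT : Measurable fun p : α × ℝ => (p.1, condCDF ρ p.1 p.2) :=
    measurable_fst.prodMk (measurable_condCDF_prod ρ)
  ext s hs
  rw [Measure.map_apply hT hs, Measure.prod_apply hs]
  refine (congrArg (fun μ : Measure (α × ℝ) => μ (_ ⁻¹' s))
    (fst_compProd_condCDFKernel ρ)).symm.trans ?_
  rw [Measure.compProd_apply (hT hs)]
  refine lintegral_congr_ae (hρ.mono fun a ha => ?_)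
  simp only
  rw [← map_condCDF_eq_volume (ρ := ρ) (a := a),
    Measure.map_apply (measurable_condCDF_right ρ a) (measurable_prodMk_left hs)]
  rfl

lemma integral_gammaPerp_condCDF {ρ : Measure (α × ℝ)} {a : α}
    [NullSingletonClass (condCDF ρ a).measure] (z : ℝ) :
    ∫ x, gammaPerp z (condCDF ρ a x) ∂(condCDF ρ a).measure = 0 := by
  rw [← integral_gammaPerp_unitInterval z, ← map_condCDF_eq_volume (ρ := ρ) (a := a),
    integral_map (measurable_condCDF_right ρ a).aemeasurable
      (by unfold gammaPerp; fun_prop)]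

end ConditionalCDF

section ConditionalIndependence

open Set Filter Topology

lemma ext_prod_of_Iic {μ ν : Measure (ℝ × ℝ)} [IsFiniteMeasure μ]
    (h : ∀ y z, μ (Iic y ×ˢ Iic z) = ν (Iic y ×ˢ Iic z)) : μ = ν := by
  have h1 : ∀ y B, MeasurableSet B → μ (Iic y ×ˢ B) = ν (Iic y ×ˢ B) := by
    intro y B hB
    have heq : (μ.restrict (Prod.fst ⁻¹' Iic y)).map Prod.snd =
        (ν.restrict (Prod.fst ⁻¹' Iic y)).map Prod.snd := by
      refine Measure.ext_of_Iic _ _ fun z => ?_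
      simpa only [Measure.map_apply measurable_snd measurableSet_Iic,
        Measure.restrict_apply (measurable_snd measurableSet_Iic), inter_comm, ← Set.prod_eq]
        using h y z
    simpa only [Measure.map_apply measurable_snd hB, inter_comm,
      Measure.restrict_apply (measurable_snd hB), ← Set.prod_eq]
      using congrArg (fun m => m B) heq
  refine Measure.ext_prod fun {A B} hA hB => ?_
  have heq : (μ.restrict (Prod.snd ⁻¹' B)).map Prod.fst =
      (ν.restrict (Prod.snd ⁻¹' B)).map Prod.fst := by
    refine Measure.ext_of_Iic _ _ fun y => ?_
    simpa only [Measure.map_apply measurable_fst measurableSet_Iic,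
      Measure.restrict_apply (measurable_fst measurableSet_Iic), ← Set.prod_eq] using h1 y B hB
  simpa only [Measure.map_apply measurable_fst hA,
    Measure.restrict_apply (measurable_fst hA), ← Set.prod_eq] using congrArg (fun m => m A) heq

variable {Ω : Type*} [MeasurableSpace Ω] {P : Measure Ω} [IsProbabilityMeasure P] {U Y Z : Ω → ℝ}

lemma condExp_indicator_le_eq_condCDF (hU : Measurable U) (hY : Measurable Y) (y : ℝ) :
    P[indicator {ω | Y ω ≤ y} (fun _ => (1 : ℝ)) | MeasurableSpace.comap U inferInstance] =ᵐ[P]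
      fun ω => condCDF (P.map fun ω => (U ω, Y ω)) (U ω) y := by
  have hS : MeasurableSet {ω | Y ω ≤ y} := measurableSet_le hY measurable_const
  have hF := measurable_condCDF (P.map fun ω => (U ω, Y ω)) y
  have : IsProbabilityMeasure (P.map fun ω => (U ω, Y ω)) :=
    Measure.isProbabilityMeasure_map (hU.prodMk hY).aemeasurable
  have hint : Integrable (fun ω => condCDF (P.map fun ω => (U ω, Y ω)) (U ω) y) P :=
    Integrable.of_bound (C := 1) (hF.comp hU).aestronglyMeasurable (ae_of_all _ fun ω => by
      rw [Real.norm_of_nonneg (condCDF_nonneg _ _ _)]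
      exact condCDF_le_one _ _ _)
  refine (ae_eq_condExp_of_forall_setIntegral_eq hU.comap_le
    ((integrable_const 1).indicator hS) (fun _ _ _ => hint.integrableOn) ?_ ?_).symm
  · rintro _ ⟨A, hA, rfl⟩ -
    have h := setIntegral_condCDF (P.map fun ω => (U ω, Y ω)) y hA
    rw [Measure.fst_map_prodMk hY, setIntegral_map hA hF.aestronglyMeasurable hU.aemeasurable,
      measureReal_def, Measure.map_apply (hU.prodMk hY) (hA.prod measurableSet_Iic)] at h
    rw [h, setIntegral_indicator hS, setIntegral_const, smul_eq_mul, mul_one]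
    rfl
  · exact (hF.comp (comap_measurable U)).aestronglyMeasurable

/-- Conditional independence given `σ(U)` in terms of the joint law and the conditional
distribution functions. -/
lemma condIndep_iff_measure_eq_lintegral (hU : Measurable U) (hY : Measurable Y)
    (hZ : Measurable Z) :
    (∀ y z : ℝ, P[indicator {ω | Y ω ≤ y ∧ Z ω ≤ z} (fun _ => (1 : ℝ)) |
        MeasurableSpace.comap U inferInstance] =ᵐ[P] fun ω =>
          (P[indicator {ω' | Y ω' ≤ y} (fun _ => (1 : ℝ)) |
            MeasurableSpace.comap U inferInstance]) ω *
          (P[indicator {ω' | Z ω' ≤ z} (fun _ => (1 : ℝ)) |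
            MeasurableSpace.comap U inferInstance]) ω) ↔
    ∀ y z A, MeasurableSet A → P (U ⁻¹' A ∩ {ω | Y ω ≤ y ∧ Z ω ≤ z}) =
      ∫⁻ u in A, ENNReal.ofReal (condCDF (P.map fun ω => (U ω, Y ω)) u y) *
        ENNReal.ofReal (condCDF (P.map fun ω => (U ω, Z ω)) u z) ∂(P.map U) := by
  refine forall_congr' fun y => forall_congr' fun z => ?_
  set F := condCDF (P.map fun ω => (U ω, Y ω))
  set G := condCDF (P.map fun ω => (U ω, Z ω))
  set S := {ω | Y ω ≤ y ∧ Z ω ≤ z} with hSdef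
  have hS : MeasurableSet S :=
    (measurableSet_le hY measurable_const).inter (measurableSet_le hZ measurable_const)
  have hF : Measurable fun u => F u y := measurable_condCDF _ y
  have hG : Measurable fun u => G u z := measurable_condCDF _ z
  have hnn : ∀ u, 0 ≤ F u y * G u z := fun u =>
    mul_nonneg (condCDF_nonneg _ _ _) (condCDF_nonneg _ _ _)
  have hint : Integrable (fun ω => F (U ω) y * G (U ω) z) P :=
    Integrable.of_bound (C := 1) ((hF.mul hG).comp hU).aestronglyMeasurable
      (ae_of_all _ fun ω => by
        rw [Real.norm_of_nonneg (hnn _)]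
        exact mul_le_one₀ (condCDF_le_one _ _ _) (condCDF_nonneg _ _ _) (condCDF_le_one _ _ _))
  have hind : Integrable (indicator S fun _ => (1 : ℝ)) P := (integrable_const 1).indicator hS
  have hprod := (condExp_indicator_le_eq_condCDF (P := P) hU hY y).mul
    (condExp_indicator_le_eq_condCDF (P := P) hU hZ z)
  have hset : ∀ A, MeasurableSet A →
      (P (U ⁻¹' A ∩ S) = ∫⁻ u in A, ENNReal.ofReal (F u y) * ENNReal.ofReal (G u z) ∂(P.map U) ↔
        ∫ ω in U ⁻¹' A, F (U ω) y * G (U ω) z ∂P =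
          ∫ ω in U ⁻¹' A, indicator S (fun _ => (1 : ℝ)) ω ∂P) := by
    intro A hA
    have hr : ∫⁻ u in A, ENNReal.ofReal (F u y) * ENNReal.ofReal (G u z) ∂(P.map U) =
        ENNReal.ofReal (∫ ω in U ⁻¹' A, F (U ω) y * G (U ω) z ∂P) := by
      rw [ofReal_integral_eq_lintegral_ofReal hint.integrableOn (ae_of_all _ fun ω => hnn (U ω))]
      exact (setLIntegral_map hA (hF.ennreal_ofReal.mul hG.ennreal_ofReal) hU).trans
        (lintegral_congr fun ω => (ENNReal.ofReal_mul (condCDF_nonneg _ _ _)).symm)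
    rw [hr, setIntegral_indicator hS, setIntegral_const, smul_eq_mul, mul_one,
      ← ofReal_measureReal, ENNReal.ofReal_eq_ofReal_iff measureReal_nonneg
        (integral_nonneg fun ω => hnn (U ω)), eq_comm]
  constructor
  · intro h A hA
    rw [hset A hA, ← setIntegral_condExp hU.comap_le hind ⟨A, hA, rfl⟩]
    refine integral_congr_ae (ae_restrict_of_ae ?_)
    exact (h.trans hprod).symm
  · intro h
    refine EventuallyEq.trans ?_ hprod.symm
    refine (ae_eq_condExp_of_forall_setIntegral_eq hU.comap_le hind
      (fun _ _ _ => hint.integrableOn) ?_ ?_).symm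
    · rintro _ ⟨A, hA, rfl⟩ -
      exact (hset A hA).1 (h A hA)
    · exact ((hF.mul hG).comp (comap_measurable U)).aestronglyMeasurable

lemma map_eq_compProd_of_measure_eq_lintegral (hU : Measurable U) (hY : Measurable Y)
    (hZ : Measurable Z)
    (h : ∀ y z A, MeasurableSet A → P (U ⁻¹' A ∩ {ω | Y ω ≤ y ∧ Z ω ≤ z}) =
      ∫⁻ u in A, ENNReal.ofReal (condCDF (P.map fun ω => (U ω, Y ω)) u y) *
        ENNReal.ofReal (condCDF (P.map fun ω => (U ω, Z ω)) u z) ∂(P.map U)) :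
    P.map (fun ω => (U ω, Y ω, Z ω)) = P.map U ⊗ₘ
      (condCDFKernel (P.map fun ω => (U ω, Y ω)) ×ₖ condCDFKernel (P.map fun ω => (U ω, Z ω))) := by
  have hT : Measurable fun ω => (U ω, Y ω, Z ω) := hU.prodMk (hY.prodMk hZ)
  refine Measure.ext_prod fun {A C} hA hC => ?_
  set ρ := P.map U ⊗ₘ
    (condCDFKernel (P.map fun ω => (U ω, Y ω)) ×ₖ condCDFKernel (P.map fun ω => (U ω, Z ω)))
    with hρ
  have heq : ((P.map (fun ω => (U ω, Y ω, Z ω))).restrict (Prod.fst ⁻¹' A)).map Prod.snd =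
      (ρ.restrict (Prod.fst ⁻¹' A)).map Prod.snd := by
    refine ext_prod_of_Iic fun y z => ?_
    have hR : MeasurableSet (Iic y ×ˢ Iic z) := measurableSet_Iic.prod measurableSet_Iic
    simp only [Measure.map_apply measurable_snd hR, Measure.restrict_apply (measurable_snd hR)]
    rw [inter_comm, ← Set.prod_eq, Measure.map_apply hT (hA.prod hR), hρ,
      Measure.compProd_apply_prod hA hR]
    refine (h y z A hA).trans (lintegral_congr fun u => ?_)
    rw [Kernel.prod_apply, Measure.prod_prod, condCDFKernel_apply, condCDFKernel_apply,
      measure_condCDF_Iic, measure_condCDF_Iic]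
  simpa only [Measure.map_apply measurable_snd hC, inter_comm,
    Measure.restrict_apply (measurable_snd hC), ← Set.prod_eq] using congrArg (fun m => m C) heq

end ConditionalIndependence

section MomentConditions

open Set Filter Topology

@[fun_prop]
lemma continuous_gammaPerp (z : ℝ) : Continuous (gammaPerp z) := by
  unfold gammaPerp
  fun_prop

lemma exists_abs_gammaPerp_le (z : ℝ) : ∃ C, ∀ t ∈ Icc (0 : ℝ) 1, |gammaPerp z t| ≤ C :=
  isCompact_Icc.exists_bound_of_continuousOn (continuous_gammaPerp z).continuousOn

lemma measurable_condCDF_comp {Ω : Type*} [MeasurableSpace Ω] {P : Measure Ω} {U Y : Ω → ℝ}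
    (hU : Measurable U) (hY : Measurable Y) :
    Measurable fun ω => condCDF (P.map fun ω => (U ω, Y ω)) (U ω) (Y ω) :=
  (measurable_condCDF_prod (P.map fun ω => (U ω, Y ω))).comp (hU.prodMk hY)

variable {Ω : Type*} [MeasurableSpace Ω] {P : Measure Ω} [IsProbabilityMeasure P] {U Y Z : Ω → ℝ}

lemma ae_nullSingletonClass_condCDF_comp {W : Ω → ℝ} {g : ℝ → ℝ} (hW : Measurable W)
    (hY : Measurable Y) (hg : Measurable g)
    (hac : P.map (fun ω => (W ω, Y ω)) ≪ (volume : Measure (ℝ × ℝ))) :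
    ∀ᵐ u ∂(P.map fun ω => g (W ω)),
      NullSingletonClass (condCDF (P.map fun ω => (g (W ω), Y ω)) u).measure := by
  have hfin : (volume : Measure ℝ).toFinite ≪ volume := toFinite_absolutelyContinuous _
  have hnull : NullSingletonClass (volume : Measure ℝ).toFinite :=
    ⟨fun x => hfin (measure_singleton (μ := volume) x)⟩
  have h1 : P.map (fun ω => (W ω, Y ω)) ≪ (volume : Measure ℝ).prod volume.toFinite :=
    hac.trans (Measure.AbsolutelyContinuous.rfl.prod (absolutelyContinuous_toFinite _))
  have h2 := (absolutelyContinuous_fst_prod h1).map (f := Prod.map g id) (by fun_prop)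
  rw [Measure.map_map (by fun_prop) (by fun_prop), Measure.fst_map_prodMk hY,
    ← Measure.map_prod_map _ _ hg measurable_id, Measure.map_map hg hW, Measure.map_id] at h2
  have hfst : (P.map fun ω => (g (W ω), Y ω)).fst = P.map fun ω => g (W ω) :=
    Measure.fst_map_prodMk hY
  rw [← hfst]
  refine ae_nullSingletonClass_condCDF (ν := (volume : Measure ℝ).toFinite) ?_
  rw [hfst]
  exact h2

lemma condCDF_mem_Icc {α : Type*} [MeasurableSpace α] (ρ : Measure (α × ℝ)) (a : α) (y : ℝ) :
    condCDF ρ a y ∈ Icc (0 : ℝ) 1 :=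
  ⟨condCDF_nonneg ρ a y, condCDF_le_one ρ a y⟩

lemma integrable_gammaPerp_comp {f : Ω → ℝ} (hf : Measurable f) (h : ∀ ω, f ω ∈ Icc (0 : ℝ) 1)
    (z : ℝ) : Integrable (fun ω => gammaPerp z (f ω)) P := by
  obtain ⟨C, hC⟩ := exists_abs_gammaPerp_le z
  exact Integrable.of_bound (C := C) (by fun_prop) (ae_of_all _ fun ω => hC _ (h ω))

lemma integrable_gammaPerp_mul_gammaPerp {f g : Ω → ℝ} (hf : Measurable f)
    (hf' : ∀ ω, f ω ∈ Icc (0 : ℝ) 1) (hg : Measurable g) (hg' : ∀ ω, g ω ∈ Icc (0 : ℝ) 1)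
    (y z : ℝ) : Integrable (fun ω => gammaPerp z (f ω) * gammaPerp y (g ω)) P := by
  obtain ⟨C, hC⟩ := exists_abs_gammaPerp_le z
  exact (integrable_gammaPerp_comp hg hg' y).bdd_mul (c := C) (by fun_prop)
    (ae_of_all _ fun ω => hC _ (hf' ω))

lemma setIntegral_gammaPerp_condCDF (hU : Measurable U) (hY : Measurable Y)
    (hY0 : ∀ᵐ u ∂(P.map U), NullSingletonClass (condCDF (P.map fun ω => (U ω, Y ω)) u).measure)
    (z : ℝ) {A : Set ℝ} (hA : MeasurableSet A) :
    ∫ ω in U ⁻¹' A, gammaPerp z (condCDF (P.map fun ω => (U ω, Y ω)) (U ω) (Y ω)) ∂P = 0 := by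
  have hfst : (P.map fun ω => (U ω, Y ω)).fst = P.map U := Measure.fst_map_prodMk hY
  rw [← hfst] at hY0
  have hlaw := map_condCDF_prod_eq hY0
  rw [Measure.map_map (measurable_fst.prodMk (measurable_condCDF_prod _)) (by fun_prop), hfst]
    at hlaw
  have hT := hU.prodMk (measurable_condCDF_comp (P := P) hU hY)
  have h1 := setIntegral_map (μ := P) (f := fun p : ℝ × ℝ => gammaPerp z p.2)
    (hA.prod MeasurableSet.univ) (by fun_prop) hT.aemeasurable
  have hlaw' : P.map (fun ω => (U ω, condCDF (P.map fun ω => (U ω, Y ω)) (U ω) (Y ω))) =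
    (P.map U).prod (volume.restrict (Icc (0 : ℝ) 1)) := hlaw
  rw [hlaw', ← Measure.prod_restrict, Measure.restrict_univ] at h1
  have h2 := integral_prod_mul (μ := (P.map U).restrict A) (ν := volume.restrict (Icc (0 : ℝ) 1))
    (fun _ => (1 : ℝ)) (gammaPerp z)
  simp only [one_mul, integral_gammaPerp_unitInterval, mul_zero] at h2
  rw [h2, mk_preimage_prod, preimage_univ, inter_univ] at h1
  exact h1.symm

lemma integral_gammaPerp_mul_eq_zero_of_map_eq (hU : Measurable U) (hY : Measurable Y)
    (hZ : Measurable Z)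
    (hY0 : ∀ᵐ u ∂(P.map U), NullSingletonClass (condCDF (P.map fun ω => (U ω, Y ω)) u).measure)
    (h : P.map (fun ω => (U ω, Y ω, Z ω)) = P.map U ⊗ₘ
      (condCDFKernel (P.map fun ω => (U ω, Y ω)) ×ₖ condCDFKernel (P.map fun ω => (U ω, Z ω))))
    {b : ℝ → ℝ} (hb : Measurable b) (hb' : ∃ B : ℝ, ∀ t, |b t| ≤ B) (y z : ℝ) :
    ∫ ω, b (U ω) * gammaPerp z (condCDF (P.map fun ω => (U ω, Z ω)) (U ω) (Z ω)) *
      gammaPerp y (condCDF (P.map fun ω => (U ω, Y ω)) (U ω) (Y ω)) ∂P = 0 := by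
  have : IsProbabilityMeasure (P.map U) := Measure.isProbabilityMeasure_map hU.aemeasurable
  set ρY := P.map fun ω => (U ω, Y ω)
  set ρZ := P.map fun ω => (U ω, Z ω)
  have hmY : Measurable fun p : ℝ × ℝ × ℝ => condCDF ρY p.1 p.2.1 :=
    (measurable_condCDF_prod ρY).comp (measurable_fst.prodMk measurable_snd.fst)
  have hmZ : Measurable fun p : ℝ × ℝ × ℝ => condCDF ρZ p.1 p.2.2 :=
    (measurable_condCDF_prod ρZ).comp (measurable_fst.prodMk measurable_snd.snd)
  have hm : Measurable fun p : ℝ × ℝ × ℝ => b p.1 * gammaPerp z (condCDF ρZ p.1 p.2.2) *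
      gammaPerp y (condCDF ρY p.1 p.2.1) := by fun_prop
  have h1 := integral_map (μ := P) (hU.prodMk (hY.prodMk hZ)).aemeasurable hm.aestronglyMeasurable
  refine h1.symm.trans ?_
  rw [h, Measure.integral_compProd]
  · refine integral_eq_zero_of_ae (hY0.mono fun u hu => ?_)
    simp only [Kernel.prod_apply, Pi.zero_apply]
    have h2 := integral_prod_mul (μ := condCDFKernel ρY u) (ν := condCDFKernel ρZ u)
      (fun x => gammaPerp y (condCDF ρY u x)) (fun x => b u * gammaPerp z (condCDF ρZ u x))
    rw [condCDFKernel_apply ρY, integral_gammaPerp_condCDF, zero_mul] at h2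
    refine Eq.trans (integral_congr_ae (ae_of_all _ fun p => ?_)) h2
    exact mul_comm _ _
  · obtain ⟨B, hB⟩ := hb'
    simp_rw [mul_assoc]
    exact (integrable_gammaPerp_mul_gammaPerp hmZ (fun _ => condCDF_mem_Icc _ _ _) hmY
      (fun _ => condCDF_mem_Icc _ _ _) y z).bdd_mul (c := B)
      (hb.comp measurable_fst).aestronglyMeasurable (ae_of_all _ fun p => hB _)

lemma setIntegral_exp_mul_exp {f g : Ω → ℝ} (hf : Measurable f) (hf' : ∀ ω, f ω ∈ Icc (0 : ℝ) 1)
    (hg : Measurable g) (hg' : ∀ ω, g ω ∈ Icc (0 : ℝ) 1) {y z : ℝ} {A : Set Ω}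
    (hf0 : ∫ ω in A, gammaPerp y (f ω) ∂P = 0) (hg0 : ∫ ω in A, gammaPerp z (g ω) ∂P = 0)
    (hfg : ∫ ω in A, gammaPerp z (g ω) * gammaPerp y (f ω) ∂P = 0) :
    y * z * ∫ ω in A, Real.exp (y * f ω) * Real.exp (z * g ω) ∂P =
      P.real A * ((Real.exp y - 1) * (Real.exp z - 1)) := by
  have hif := (integrable_gammaPerp_comp (P := P) hf hf' y).integrableOn (s := A)
  have hig := (integrable_gammaPerp_comp (P := P) hg hg' z).integrableOn (s := A)
  have hifg := (integrable_gammaPerp_mul_gammaPerp (P := P) hg hg' hf hf' y z).integrableOn (s := A)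
  have hexpand : ∀ ω, y * z * (Real.exp (y * f ω) * Real.exp (z * g ω)) =
      gammaPerp z (g ω) * gammaPerp y (f ω) + (Real.exp z - 1) * gammaPerp y (f ω) +
        (Real.exp y - 1) * gammaPerp z (g ω) + (Real.exp y - 1) * (Real.exp z - 1) := by
    intro ω
    simp only [gammaPerp, mul_comm (f ω) y, mul_comm (g ω) z]
    ring
  have h1 : IntegrableOn (fun ω => gammaPerp z (g ω) * gammaPerp y (f ω) +
      (Real.exp z - 1) * gammaPerp y (f ω)) A P := hifg.add (hif.const_mul _)
  have h2 : IntegrableOn (fun ω => gammaPerp z (g ω) * gammaPerp y (f ω) +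
      (Real.exp z - 1) * gammaPerp y (f ω) + (Real.exp y - 1) * gammaPerp z (g ω)) A P :=
    h1.add (hig.const_mul _)
  rw [← integral_const_mul]
  simp_rw [hexpand]
  rw [integral_add h2 (integrable_const _), integral_add h1 (hig.const_mul _),
    integral_add hifg (hif.const_mul _), integral_const_mul, integral_const_mul, hf0, hg0, hfg,
    setIntegral_const, smul_eq_mul]
  ring

lemma integral_exp_unitInterval {y : ℝ} :
    y * ∫ t, Real.exp (y * t) ∂(volume.restrict (Icc (0 : ℝ) 1)) = Real.exp y - 1 := by
  have h := integral_gammaPerp_unitInterval y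
  simp only [gammaPerp] at h
  rw [integral_sub (Continuous.integrableOn_Icc (by fun_prop)) (integrable_const _),
    integral_const_mul] at h
  simp only [mul_comm _ y] at h
  simpa [sub_eq_zero] using h

/-- If the bivariate exponential moments vanish on every event of `σ(U)`, the pair of transformed
variables is uniform on the unit square and independent of `U`. -/
lemma map_eq_prod_of_setIntegral_gammaPerp {f g : Ω → ℝ} (hU : Measurable U) (hf : Measurable f)
    (hf' : ∀ ω, f ω ∈ Icc (0 : ℝ) 1) (hg : Measurable g) (hg' : ∀ ω, g ω ∈ Icc (0 : ℝ) 1)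
    (hf0 : ∀ y A, MeasurableSet A → ∫ ω in U ⁻¹' A, gammaPerp y (f ω) ∂P = 0)
    (hg0 : ∀ z A, MeasurableSet A → ∫ ω in U ⁻¹' A, gammaPerp z (g ω) ∂P = 0)
    (hfg : ∀ y ∈ Ioo (0 : ℝ) 1, ∀ z ∈ Ioo (0 : ℝ) 1, ∀ A, MeasurableSet A →
      ∫ ω in U ⁻¹' A, gammaPerp z (g ω) * gammaPerp y (f ω) ∂P = 0) :
    P.map (fun ω => (U ω, f ω, g ω)) = (P.map U).prod
      ((volume.restrict (Icc (0 : ℝ) 1)).prod (volume.restrict (Icc (0 : ℝ) 1))) := by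
  have hT : Measurable fun ω => (U ω, f ω, g ω) := hU.prodMk (hf.prodMk hg)
  have : IsProbabilityMeasure (P.map U) := Measure.isProbabilityMeasure_map hU.aemeasurable
  refine Measure.ext_prod fun {A C} hA hC => ?_
  have heq : (P.restrict (U ⁻¹' A)).map (fun ω => (f ω, g ω)) = P (U ⁻¹' A) •
      ((volume.restrict (Icc (0 : ℝ) 1)).prod (volume.restrict (Icc (0 : ℝ) 1))) := by
    have : IsFiniteMeasure (P (U ⁻¹' A) •
        ((volume.restrict (Icc (0 : ℝ) 1)).prod (volume.restrict (Icc (0 : ℝ) 1)))) :=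
      Measure.smul_finite _ (measure_ne_top _ _)
    refine ext_prod_of_integral_exp_eq ?_ ?_ fun y hy z hz => ?_
    · refine (ae_map_iff (hf.prodMk hg).aemeasurable
        (measurableSet_Icc.prod measurableSet_Icc)).2 (ae_of_all _ fun ω => ⟨hf' ω, hg' ω⟩)
    · refine Measure.ae_smul_measure ?_ _
      rw [Measure.prod_restrict]
      exact ae_restrict_mem (measurableSet_Icc.prod measurableSet_Icc)
    · rw [integral_map (hf.prodMk hg).aemeasurable (by fun_prop), integral_smul_measure,
        integral_prod_mul (fun t => Real.exp (y * t)) (fun t => Real.exp (z * t)), smul_eq_mul]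
      have h1 := setIntegral_exp_mul_exp hf hf' hg hg' (hf0 y A hA) (hg0 z A hA)
        (hfg y hy z hz A hA)
      rw [← integral_exp_unitInterval, ← integral_exp_unitInterval, measureReal_def] at h1
      refine mul_left_cancel₀ (mul_ne_zero hy.1.ne' hz.1.ne') (h1.trans ?_)
      ring
  have h2 := congrArg (fun m => m C) heq
  simp only [Measure.smul_apply, smul_eq_mul] at h2
  rw [Measure.map_apply (hf.prodMk hg) hC, Measure.restrict_apply (hf.prodMk hg hC)] at h2
  rw [Measure.map_apply hT (hA.prod hC), Measure.prod_prod, Measure.map_apply hU hA, ← h2,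
    inter_comm]
  rfl

lemma measure_eq_lintegral_of_map_eq_prod (hU : Measurable U) (hY : Measurable Y)
    (hZ : Measurable Z)
    (hY0 : ∀ᵐ u ∂(P.map U), NullSingletonClass (condCDF (P.map fun ω => (U ω, Y ω)) u).measure)
    (hZ0 : ∀ᵐ u ∂(P.map U), NullSingletonClass (condCDF (P.map fun ω => (U ω, Z ω)) u).measure)
    (h : P.map (fun ω => (U ω, condCDF (P.map fun ω => (U ω, Y ω)) (U ω) (Y ω),
        condCDF (P.map fun ω => (U ω, Z ω)) (U ω) (Z ω))) = (P.map U).prod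
      ((volume.restrict (Icc (0 : ℝ) 1)).prod (volume.restrict (Icc (0 : ℝ) 1))))
    (y z : ℝ) {A : Set ℝ} (hA : MeasurableSet A) :
    P (U ⁻¹' A ∩ {ω | Y ω ≤ y ∧ Z ω ≤ z}) =
      ∫⁻ u in A, ENNReal.ofReal (condCDF (P.map fun ω => (U ω, Y ω)) u y) *
        ENNReal.ofReal (condCDF (P.map fun ω => (U ω, Z ω)) u z) ∂(P.map U) := by
  have hae : ∀ {X : Ω → ℝ}, Measurable X →
      (∀ᵐ u ∂(P.map U), NullSingletonClass (condCDF (P.map fun ω => (U ω, X ω)) u).measure) →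
      ∀ x, ∀ᵐ ω ∂P, condCDF (P.map fun ω => (U ω, X ω)) (U ω) (X ω) ≤
        condCDF (P.map fun ω => (U ω, X ω)) (U ω) x ↔ X ω ≤ x := by
    intro X hX hX0 x
    rw [← Measure.fst_map_prodMk (X := U) hX] at hX0
    exact ae_of_ae_map (hU.prodMk hX).aemeasurable (ae_condCDF_le_iff_of_prod hX0 x)
  have hT := hU.prodMk ((measurable_condCDF_comp (P := P) hU hY).prodMk
    (measurable_condCDF_comp (P := P) hU hZ))
  set F := condCDF (P.map fun ω => (U ω, Y ω)) with hF
  set G := condCDF (P.map fun ω => (U ω, Z ω)) with hG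
  have hFm : Measurable fun u => F u y := measurable_condCDF _ y
  have hGm : Measurable fun u => G u z := measurable_condCDF _ z
  have hD : MeasurableSet {p : ℝ × ℝ × ℝ | p.1 ∈ A ∧ p.2.1 ≤ F p.1 y ∧ p.2.2 ≤ G p.1 z} :=
    (measurable_fst hA).inter ((measurableSet_le measurable_snd.fst (hFm.comp measurable_fst)).inter
      (measurableSet_le measurable_snd.snd (hGm.comp measurable_fst)))
  calc P (U ⁻¹' A ∩ {ω | Y ω ≤ y ∧ Z ω ≤ z})
      = P ((fun ω => (U ω, F (U ω) (Y ω), G (U ω) (Z ω))) ⁻¹'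
          {p : ℝ × ℝ × ℝ | p.1 ∈ A ∧ p.2.1 ≤ F p.1 y ∧ p.2.2 ≤ G p.1 z}) := by
        refine measure_congr (Filter.eventuallyEq_set.2 ?_)
        filter_upwards [hae hY hY0 y, hae hZ hZ0 z] with ω h1 h2
        exact and_congr Iff.rfl (and_congr h1.symm h2.symm)
    _ = _ := by
        rw [← Measure.map_apply hT hD, h, Measure.prod_apply hD, ← lintegral_indicator hA]
        refine lintegral_congr fun u => ?_
        by_cases hu : u ∈ A
        · have hs : Prod.mk u ⁻¹' {p : ℝ × ℝ × ℝ | p.1 ∈ A ∧ p.2.1 ≤ F p.1 y ∧ p.2.2 ≤ G p.1 z} =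
              Iic (F u y) ×ˢ Iic (G u z) := by
            ext p
            simp [hu, Prod.le_def]
          rw [hs, Measure.prod_prod, volume_restrict_Icc_Iic (condCDF_mem_Icc _ _ _),
            volume_restrict_Icc_Iic (condCDF_mem_Icc _ _ _), indicator_of_mem hu]
        · have hs : Prod.mk u ⁻¹' {p : ℝ × ℝ × ℝ | p.1 ∈ A ∧ p.2.1 ≤ F p.1 y ∧ p.2.2 ≤ G p.1 z} =
              ∅ := by
            ext p
            simp [hu]
          rw [hs, measure_empty, indicator_of_notMem hu]

end MomentConditions

/-- Lemma 1 of the paper: suppose `(Y,Z,W)` has a joint density, `U = F_W(W)`,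
`Ỹ = F_{Y|U}(Y|U)`, `Z̃ = F_{Z|U}(Z|U)`, and the family `(β_u)` is such that the moment
conditions `E[β_u(U)γ_z^⊥(Z̃)γ_y^⊥(Ỹ)] = 0` for all `(u,y,z) ∈ [0,1]³` imply
`E[γ_z^⊥(Z̃)γ_y^⊥(Ỹ) | σ(U)] = 0` a.s. for all `(y,z) ∈ [0,1]²`.  Then conditional
independence of `Y` and `Z` given `σ(U)` is equivalent to the moment conditions. -/
theorem stmt0 {Ω : Type*} [MeasurableSpace Ω] (P : Measure Ω) [IsProbabilityMeasure P]
    (Y Z W : Ω → ℝ) (hY : Measurable Y) (hZ : Measurable Z) (hW : Measurable W)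
    (hac : P.map (fun ω => (Y ω, Z ω, W ω)) ≪ (volume : Measure (ℝ × ℝ × ℝ)))
    (β : ℝ → ℝ → ℝ) (hβmeas : ∀ u, Measurable (β u))
    (hβbdd : ∀ u, ∃ B : ℝ, ∀ t, |β u t| ≤ B)
    -- the transformed variables
    (U Ytil Ztil : Ω → ℝ)
    (hU : U = fun ω => ((P.map W) (Set.Iic (W ω))).toReal)
    (hYtil : Ytil = fun ω => condCDF (P.map (fun ω' => (U ω', Y ω'))) (U ω) (Y ω))
    (hZtil : Ztil = fun ω => condCDF (P.map (fun ω' => (U ω', Z ω'))) (U ω) (Z ω))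
    -- the σ-algebra generated by U
    (m : MeasurableSpace Ω) (hm : m = MeasurableSpace.comap U inferInstance)
    -- the completeness property of the family (β_u)
    (hβ : (∀ u ∈ Set.Icc (0:ℝ) 1, ∀ y ∈ Set.Icc (0:ℝ) 1, ∀ z ∈ Set.Icc (0:ℝ) 1,
        ∫ ω, β u (U ω) * gammaPerp z (Ztil ω) * gammaPerp y (Ytil ω) ∂P = 0) →
      ∀ y ∈ Set.Icc (0:ℝ) 1, ∀ z ∈ Set.Icc (0:ℝ) 1,
        P[fun ω => gammaPerp z (Ztil ω) * gammaPerp y (Ytil ω) | m] =ᵐ[P] 0) :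
    -- conditional independence ↔ moment conditions
    ((∀ y z : ℝ,
        P[Set.indicator (setOf (fun ω => Y ω ≤ y ∧ Z ω ≤ z)) (fun _ => (1:ℝ)) | m] =ᵐ[P]
          fun ω => ((P[Set.indicator (setOf (fun ω' => Y ω' ≤ y)) (fun _ => (1:ℝ)) | m]) ω) *
            ((P[Set.indicator (setOf (fun ω' => Z ω' ≤ z)) (fun _ => (1:ℝ)) | m]) ω)) ↔
      (∀ u ∈ Set.Icc (0:ℝ) 1, ∀ y ∈ Set.Icc (0:ℝ) 1, ∀ z ∈ Set.Icc (0:ℝ) 1,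
        ∫ ω, β u (U ω) * gammaPerp z (Ztil ω) * gammaPerp y (Ytil ω) ∂P = 0)) := by
  subst hm
  have hWint : IsProbabilityMeasure (P.map W) := Measure.isProbabilityMeasure_map hW.aemeasurable
  set g : ℝ → ℝ := fun w => ((P.map W) (Set.Iic w)).toReal with hgdef
  have hg : Measurable g := Monotone.measurable fun a b hab =>
    ENNReal.toReal_mono (measure_ne_top (P.map W) _) (measure_mono (Set.Iic_subset_Iic.2 hab))
  have hUm : Measurable U := by
    rw [hU]
    exact hg.comp hW
  have hacY : P.map (fun ω => (W ω, Y ω)) ≪ (volume : Measure (ℝ × ℝ)) := by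
    have hq : Measure.QuasiMeasurePreserving (fun p : ℝ × ℝ × ℝ => (p.2.2, p.1)) volume volume :=
      Measure.measurePreserving_swap.quasiMeasurePreserving.comp
        (QuasiMeasurePreserving.prodMap (Measure.QuasiMeasurePreserving.id (volume : Measure ℝ))
          Measure.quasiMeasurePreserving_snd)
    have h := (hac.map hq.measurable).trans hq.absolutelyContinuous
    rwa [Measure.map_map hq.measurable (hY.prodMk (hZ.prodMk hW))] at h
  have hacZ : P.map (fun ω => (W ω, Z ω)) ≪ (volume : Measure (ℝ × ℝ)) := by
    have hq : Measure.QuasiMeasurePreserving (fun p : ℝ × ℝ × ℝ => (p.2.2, p.2.1)) volume volume :=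
      Measure.measurePreserving_swap.quasiMeasurePreserving.comp
        Measure.quasiMeasurePreserving_snd
    have h := (hac.map hq.measurable).trans hq.absolutelyContinuous
    rwa [Measure.map_map hq.measurable (hY.prodMk (hZ.prodMk hW))] at h
  have hY0 : ∀ᵐ u ∂(P.map U),
      NullSingletonClass (condCDF (P.map fun ω => (U ω, Y ω)) u).measure := by
    rw [hU]
    exact ae_nullSingletonClass_condCDF_comp hW hY hg hacY
  have hZ0 : ∀ᵐ u ∂(P.map U),
      NullSingletonClass (condCDF (P.map fun ω => (U ω, Z ω)) u).measure := by
    rw [hU]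
    exact ae_nullSingletonClass_condCDF_comp hW hZ hg hacZ
  clear hU
  subst hYtil hZtil
  refine (condIndep_iff_measure_eq_lintegral hUm hY hZ).trans ?_
  constructor
  · intro h u _ y _ z _
    exact integral_gammaPerp_mul_eq_zero_of_map_eq hUm hY hZ hY0
      (map_eq_compProd_of_measure_eq_lintegral hUm hY hZ h) (hβmeas u) (hβbdd u) y z
  · intro h y z A hA
    have hYm := measurable_condCDF_comp (P := P) hUm hY
    have hZm := measurable_condCDF_comp (P := P) hUm hZ
    refine measure_eq_lintegral_of_map_eq_prod hUm hY hZ hY0 hZ0 ?_ y z hA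
    refine map_eq_prod_of_setIntegral_gammaPerp hUm hYm (fun _ => condCDF_mem_Icc _ _ _) hZm
      (fun _ => condCDF_mem_Icc _ _ _)
      (fun y A hA => setIntegral_gammaPerp_condCDF hUm hY hY0 y hA)
      (fun z A hA => setIntegral_gammaPerp_condCDF hUm hZ hZ0 z hA)
      fun y hy z hz A hA => ?_
    rw [← setIntegral_condExp hUm.comap_le (integrable_gammaPerp_mul_gammaPerp hZm
      (fun _ => condCDF_mem_Icc _ _ _) hYm (fun _ => condCDF_mem_Icc _ _ _) y z) ⟨A, hA, rfl⟩]
    exact integral_eq_zero_of_ae (ae_restrict_of_ae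
      (hβ h y (Set.Ioo_subset_Icc_self hy) z (Set.Ioo_subset_Icc_self hz)))
end

section
/- Lemma A1: There exist constants C₁, C₂ > 0 depending only on q and M with the following property. For every ε ∈ (0,1) and every finite set Λ₀ of functions from S to ℝ of cardinality N such that each λ ∈ Λ has some λ' ∈ Λ₀ with sup_{s∈S} |λ(s) − λ'(s)| ≤ ε^q, there exists a finite family of pairs (g_j, Δ_j)_{j ≤ N·⌈exp(C₁/ε)⌉} of measurable functions on S such that: for every τ ∈ 𝒯 and λ ∈ Λ there is an index j with |τ(λ(s)) − g_j(s)| ≤ Δ_j(s) for all s ∈ S and (∫ Δ_j^q dμ)^{1/q} ≤ C₂·ε. In other words, the bracketing number of 𝒢 = {τ∘λ : τ ∈ 𝒯, λ ∈ Λ} in L_q(μ) at radius C₂ε is at most N(ε^q, Λ, sup-norm)·exp(C₁/ε). -/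
open MeasureTheory ProbabilityTheory

theorem card_monotone_fin_le (n m : ℕ) {x : ℝ} (hx : 0 < x) :
    (Nat.card {u : Fin n → Fin (m + 1) // Monotone u} : ℝ) ≤
      x⁻¹ ^ m * Real.exp (x * (n + m)) := by
  have hcard : Nat.card {u : Fin n → Fin (m + 1) // Monotone u} ≤ (n + m).choose m := by
    have hshift : ∀ u : {u : Fin n → Fin (m + 1) // Monotone u},
        StrictMono fun c : Fin n => (u.1 c : ℕ) + c := fun u a b hab =>
      add_lt_add_of_le_of_lt (Fin.le_def.1 (u.2 hab.le)) hab
    let code : {u : Fin n → Fin (m + 1) // Monotone u} →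
        Finset.powersetCard n (Finset.range (n + m)) := fun u =>
      ⟨Finset.univ.image fun c : Fin n => (u.1 c : ℕ) + c, by
        rw [Finset.mem_powersetCard]
        refine ⟨fun y hy => ?_, ?_⟩
        · obtain ⟨c, -, rfl⟩ := Finset.mem_image.1 hy
          have h1 := (u.1 c).isLt
          have h2 := c.isLt
          simp only [Finset.mem_range]
          omega
        · rw [Finset.card_image_of_injective _ (hshift u).injective, Finset.card_fin]⟩
    have hcode : Function.Injective code := by
      intro u v huv
      have himage := congrArg (fun s : Finset ℕ => (s : Set ℕ)) (congrArg Subtype.val huv)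
      simp only [code, Finset.coe_image, Finset.coe_univ, Set.image_univ] at himage
      have hfun := ((hshift u).range_inj (hshift v)).1 himage
      ext c
      have := congrFun hfun c
      omega
    calc Nat.card {u : Fin n → Fin (m + 1) // Monotone u}
        ≤ Nat.card (Finset.powersetCard n (Finset.range (n + m))) :=
          Nat.card_le_card_of_injective code hcode
      _ = (n + m).choose m := by
          rw [Nat.card_eq_fintype_card, Fintype.card_coe, Finset.card_powersetCard,
            Finset.card_range, Nat.choose_symm_add]
  have hbinom : ((n + m).choose m : ℝ) * x ^ m ≤ Real.exp (x * (n + m)) := by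
    calc ((n + m).choose m : ℝ) * x ^ m
        ≤ ∑ k ∈ Finset.range (n + m + 1), x ^ k * 1 ^ (n + m - k) * ((n + m).choose k : ℝ) := by
          have := Finset.single_le_sum
            (f := fun k => x ^ k * 1 ^ (n + m - k) * ((n + m).choose k : ℝ))
            (s := Finset.range (n + m + 1)) (fun k _ => by positivity)
            (Finset.mem_range.2 (by omega : m < n + m + 1))
          simpa [mul_comm] using this
      _ = (x + 1) ^ (n + m) := (add_pow x 1 (n + m)).symm
      _ ≤ Real.exp x ^ (n + m) := by
          gcongr
          exact Real.add_one_le_exp x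
      _ = Real.exp (x * (n + m)) := by
          rw [← Real.exp_nat_mul]
          push_cast
          ring_nf
  calc (Nat.card {u : Fin n → Fin (m + 1) // Monotone u} : ℝ)
      ≤ ((n + m).choose m : ℝ) := by exact_mod_cast hcard
    _ = x⁻¹ ^ m * (((n + m).choose m : ℝ) * x ^ m) := by
        have : x ^ m ≠ 0 := by positivity
        rw [inv_pow]
        field_simp
    _ ≤ x⁻¹ ^ m * Real.exp (x * (n + m)) := by gcongr

theorem measure_cdf_preimage_Ico_le (Q : Measure ℝ) [IsProbabilityMeasure Q] [NullSingletonClass Q]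
    (a b : ℝ) : Q {t | a ≤ cdf Q t ∧ cdf Q t < b} ≤ ENNReal.ofReal (b - a) := by
  have hmeas : MeasurableSet {t | a ≤ cdf Q t ∧ cdf Q t < b} :=
    (measurableSet_le measurable_const (monotone_cdf Q).measurable).inter
      (measurableSet_lt (monotone_cdf Q).measurable measurable_const)
  rw [hmeas.measure_eq_iSup_isCompact]
  refine iSup₂_le fun K hKsub => iSup_le fun hK => ?_
  rcases K.eq_empty_or_nonempty with rfl | hne
  · simp
  have hmin := hKsub (hK.sInf_mem hne)
  have hmax := hKsub (hK.sSup_mem hne)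
  have hsub : K ⊆ Set.Icc (sInf K) (sSup K) := fun t ht =>
    ⟨csInf_le hK.bddBelow ht, le_csSup hK.bddAbove ht⟩
  calc Q K ≤ Q (Set.Icc (sInf K) (sSup K)) := measure_mono hsub
    _ = Q (Set.Ioc (sInf K) (sSup K)) := measure_congr Ioc_ae_eq_Icc.symm
    _ = (cdf Q).measure (Set.Ioc (sInf K) (sSup K)) := by rw [measure_cdf]
    _ = ENNReal.ofReal (cdf Q (sSup K) - cdf Q (sInf K)) := StieltjesFunction.measure_Ioc _ _ _
    _ ≤ ENNReal.ofReal (b - a) := ENNReal.ofReal_le_ofReal (by linarith [hmin.1, hmax.2])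

theorem integral_quantile_step_le (Q : Measure ℝ) [IsProbabilityMeasure Q] [NullSingletonClass Q]
    {n : ℕ} (hn : 0 < n) {w : ℕ → ℝ} (hw : Monotone w) (hw01 : ∀ c, w c ∈ Set.Icc (0 : ℝ) 1) :
    Integrable (fun t => w (⌊n * cdf Q t⌋₊ + 1) - w ⌊n * cdf Q t⌋₊) Q ∧
      ∫ t, (w (⌊n * cdf Q t⌋₊ + 1) - w ⌊n * cdf Q t⌋₊) ∂Q ≤ 1 / n := by
  have hn' : (0 : ℝ) < n := by exact_mod_cast hn
  have hcell : Measurable fun t => ⌊n * cdf Q t⌋₊ :=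
    ((monotone_cdf Q).measurable.const_mul _).nat_floor
  have hset : ∀ c, MeasurableSet {t | ⌊n * cdf Q t⌋₊ = c} := fun c =>
    hcell (measurableSet_singleton c)
  have hmass : ∀ c, Q.real {t | ⌊n * cdf Q t⌋₊ = c} ≤ 1 / n := by
    intro c
    refine ENNReal.toReal_le_of_le_ofReal (by positivity) ?_
    have hsub : {t | ⌊n * cdf Q t⌋₊ = c} ⊆
        {t | (c : ℝ) / n ≤ cdf Q t ∧ cdf Q t < (c + 1) / n} := by
      intro t ht
      have hcdf : 0 ≤ n * cdf Q t := mul_nonneg hn'.le (cdf_nonneg Q t)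
      obtain ⟨h1, h2⟩ := (Nat.floor_eq_iff hcdf).1 ht
      exact ⟨by rw [div_le_iff₀ hn']; linarith, by rw [lt_div_iff₀ hn']; linarith⟩
    refine (measure_mono hsub).trans ((measure_cdf_preimage_Ico_le Q _ _).trans ?_)
    refine ENNReal.ofReal_le_ofReal (le_of_eq ?_)
    field_simp
    ring
  have hsum : (fun t => w (⌊n * cdf Q t⌋₊ + 1) - w ⌊n * cdf Q t⌋₊) = fun t =>
      ∑ c ∈ Finset.range (n + 1),
        {t | ⌊n * cdf Q t⌋₊ = c}.indicator (fun _ => w (c + 1) - w c) t := by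
    ext t
    have hlt : ⌊n * cdf Q t⌋₊ ∈ Finset.range (n + 1) := by
      have : ⌊n * cdf Q t⌋₊ ≤ n :=
        Nat.floor_le_of_le (mul_le_of_le_one_right hn'.le (cdf_le_one Q t))
      simp only [Finset.mem_range]
      omega
    simp only [Set.indicator_apply, Set.mem_ofPred_eq]
    rw [Finset.sum_ite_eq, if_pos hlt]
  have h_integrable : ∀ c, Integrable
      ({t | ⌊n * cdf Q t⌋₊ = c}.indicator fun _ => w (c + 1) - w c) Q := fun c =>
    (integrable_const _).indicator (hset c)
  rw [hsum]
  refine ⟨integrable_finsetSum _ fun c _ => h_integrable c, ?_⟩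
  rw [integral_finsetSum _ fun c _ => h_integrable c]
  calc ∑ c ∈ Finset.range (n + 1),
        ∫ t, {t | ⌊n * cdf Q t⌋₊ = c}.indicator (fun _ => w (c + 1) - w c) t ∂Q
      ≤ ∑ c ∈ Finset.range (n + 1), 1 / n * (w (c + 1) - w c) := by
        refine Finset.sum_le_sum fun c _ => ?_
        rw [integral_indicator_const _ (hset c), smul_eq_mul]
        exact mul_le_mul_of_nonneg_right (hmass c) (sub_nonneg.2 (hw c.le_succ))
    _ = 1 / n * (w (n + 1) - w 0) := by rw [← Finset.mul_sum, Finset.sum_range_sub]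
    _ ≤ 1 / n := mul_le_of_le_one_right (by positivity) (by
        linarith [(hw01 (n + 1)).2, (hw01 0).1])

theorem integral_shift_sub_shift_le (Q : Measure ℝ) [IsProbabilityMeasure Q] {M δ : ℝ}
    (hM : 0 ≤ M) (hδ : 0 ≤ δ) (hQ : ∀ A, MeasurableSet A → Q A ≤ ENNReal.ofReal M * volume A)
    {h : ℝ → ℝ} (hmono : Monotone h) (h01 : ∀ t, h t ∈ Set.Icc (0 : ℝ) 1) :
    ∫ t, (h (t + δ) - h (t - δ)) ∂Q ≤ 2 * δ * M := by
  have hup : Measurable fun t => h (t + δ) := hmono.measurable.comp (measurable_id.add_const δ)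
  have hlow : Measurable fun t => h (t - δ) := hmono.measurable.comp (measurable_id.sub_const δ)
  set E : Set (ℝ × ℝ) := {p | h (p.1 - δ) < p.2 ∧ p.2 ≤ h (p.1 + δ)} with hE
  have hEmeas : MeasurableSet E :=
    (measurableSet_lt (hlow.comp measurable_fst) measurable_snd).inter
      (measurableSet_le measurable_snd (hup.comp measurable_fst))
  have hfibre : ∀ y, Q ((fun t => (t, y)) ⁻¹' E) ≤
      (Set.Icc (0 : ℝ) 1).indicator (fun _ => ENNReal.ofReal (2 * δ * M)) y := by
    intro y
    by_cases hy : y ∈ Set.Icc (0 : ℝ) 1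
    · rw [Set.indicator_of_mem hy]
      have hdiam : volume ((fun t => (t, y)) ⁻¹' E) ≤ ENNReal.ofReal (2 * δ) := by
        refine (Real.volume_le_diam _).trans (Metric.ediam_le fun s hs t ht => ?_)
        rw [edist_dist, Real.dist_eq]
        refine ENNReal.ofReal_le_ofReal ?_
        have hst := hmono.reflect_lt (hs.1.trans_le ht.2)
        have hts := hmono.reflect_lt (ht.1.trans_le hs.2)
        simp only at hst hts
        exact abs_le.2 ⟨by linarith, by linarith⟩
      calc Q ((fun t => (t, y)) ⁻¹' E)
          ≤ ENNReal.ofReal M * volume ((fun t => (t, y)) ⁻¹' E) :=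
            hQ _ (measurable_prodMk_right hEmeas)
        _ ≤ ENNReal.ofReal M * ENNReal.ofReal (2 * δ) := by gcongr
        _ = ENNReal.ofReal (2 * δ * M) := by rw [← ENNReal.ofReal_mul hM, mul_comm]
    · rw [Set.indicator_of_notMem hy]
      have : (fun t => (t, y)) ⁻¹' E = ∅ := by
        ext t
        simp only [Set.mem_preimage, hE, Set.mem_ofPred_eq, Set.mem_empty_iff_false, iff_false]
        exact fun ht => hy ⟨(h01 _).1.trans ht.1.le, ht.2.trans (h01 _).2⟩
      simp [this]
  rw [integral_eq_lintegral_of_nonneg_ae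
    (ae_of_all _ fun t => sub_nonneg.2 (hmono (by linarith))) (hup.sub hlow).aestronglyMeasurable]
  refine ENNReal.toReal_le_of_le_ofReal (by positivity) ?_
  calc ∫⁻ t, ENNReal.ofReal (h (t + δ) - h (t - δ)) ∂Q
      = ∫⁻ t, volume (Prod.mk t ⁻¹' E) ∂Q := by
        refine lintegral_congr fun t => ?_
        rw [← Real.volume_Ioc]
        rfl
    _ = (Q.prod volume) E := (Measure.prod_apply hEmeas).symm
    _ = ∫⁻ y, Q ((fun t => (t, y)) ⁻¹' E) := Measure.prod_apply_symm hEmeas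
    _ ≤ ∫⁻ y, (Set.Icc (0 : ℝ) 1).indicator (fun _ => ENNReal.ofReal (2 * δ * M)) y :=
        lintegral_mono hfibre
    _ = ENNReal.ofReal (2 * δ * M) := by
        rw [lintegral_indicator_const measurableSet_Icc, Real.volume_Icc]
        simp

theorem exists_jordan_decomposition {M : ℝ} (hM : 0 < M) {τ : ℝ → ℝ}
    (hτ : ∀ t, τ t ∈ Set.Icc (-M) M) (hvar : eVariationOn τ Set.univ ≤ ENNReal.ofReal M) :
    ∃ f g : ℝ → ℝ, Monotone f ∧ Monotone g ∧ (∀ t, f t ∈ Set.Icc (0 : ℝ) 1) ∧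
      (∀ t, g t ∈ Set.Icc (0 : ℝ) 1) ∧ ∀ t, τ t = 3 * M * (f t - g t) + M := by
  have hle : ∀ s, eVariationOn τ s ≤ ENNReal.ofReal M := fun s =>
    (eVariationOn.mono τ (Set.subset_univ s)).trans hvar
  have hfin : ∀ s, eVariationOn τ s ≠ ⊤ := fun s => ((hle s).trans_lt ENNReal.ofReal_lt_top).ne
  set v : ℝ → ℝ := fun t => (eVariationOn τ (Set.Iic t)).toReal with hv
  have hv0 : ∀ t, 0 ≤ v t := fun t => ENNReal.toReal_nonneg
  have hvM : ∀ t, v t ≤ M := fun t => ENNReal.toReal_le_of_le_ofReal hM.le (hle _)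
  have hincr : ∀ a b, a ≤ b → |τ b - τ a| ≤ v b - v a := by
    intro a b hab
    have hadd : eVariationOn τ (Set.Iic a) + eVariationOn τ (Set.Icc a b) ≤
        eVariationOn τ (Set.Iic b) := by
      refine (eVariationOn.add_le_union τ fun x hx y hy => hx.trans hy.1).trans
        (eVariationOn.mono τ ?_)
      exact Set.union_subset (Set.Iic_subset_Iic.2 hab) Set.Icc_subset_Iic_self
    have hjump : |τ b - τ a| ≤ (eVariationOn τ (Set.Icc a b)).toReal := by
      have := eVariationOn.edist_le τ (Set.right_mem_Icc.2 hab) (Set.left_mem_Icc.2 hab)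
      rw [edist_dist, Real.dist_eq] at this
      exact (ENNReal.ofReal_le_iff_le_toReal (hfin _)).1 this
    have := ENNReal.toReal_mono (hfin _) hadd
    rw [ENNReal.toReal_add (hfin _) (hfin _)] at this
    linarith
  refine ⟨fun t => v t / (3 * M), fun t => (v t - τ t + M) / (3 * M), ?_, ?_, ?_, ?_, ?_⟩
  · intro a b hab
    have := abs_nonneg (τ b - τ a)
    have := hincr a b hab
    simp only
    gcongr
    linarith
  · intro a b hab
    have := le_abs_self (τ b - τ a)
    have := hincr a b hab
    simp only
    gcongr ?_ / _
    linarith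
  · exact fun t => ⟨by have := hv0 t; positivity,
      by rw [div_le_one (by positivity)]; linarith [hvM t]⟩
  · intro t
    obtain ⟨h1, h2⟩ := hτ t
    exact ⟨div_nonneg (by linarith [hv0 t]) (by positivity),
      by rw [div_le_one (by positivity)]; linarith [hvM t]⟩
  · intro t
    field_simp
    ring

theorem card_monotone_geometric_le {K d : ℕ} {θ : ℝ} (hK : 1 ≤ K) (hθ : 1 / 2 ≤ θ) (hθ1 : θ < 1) :
    (Nat.card {u : Fin (K * 2 ^ d + 2) → Fin (⌊K * θ ^ d⌋₊ + 1) // Monotone u} : ℝ) ≤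
      Real.exp (K * ((4 + 2 * d) * θ ^ d)) := by
  have hθ0 : 0 < θ := by linarith
  have hK' : (1 : ℝ) ≤ K := by exact_mod_cast hK
  set m := ⌊K * θ ^ d⌋₊
  have hmle : (m : ℝ) ≤ K * θ ^ d := Nat.floor_le (by positivity)
  have hθd : θ ^ d ≤ K * θ ^ d := le_mul_of_one_le_left (by positivity) hK'
  have hθd1 : θ ^ d ≤ 1 := pow_le_one₀ hθ0.le hθ1.le
  have hx1 : (θ / 2) ^ d ≤ θ ^ d := by gcongr; linarith
  have hinv : (((θ / 2) ^ d)⁻¹ : ℝ) ^ m ≤ Real.exp (2 * d * m) := by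
    have h4 : (θ / 2)⁻¹ ≤ Real.exp 2 := by
      have h1 : (θ / 2)⁻¹ ≤ 4 := by
        rw [inv_le_comm₀ (by positivity) (by norm_num)]
        linarith
      have h2 := Real.add_one_le_exp (1 : ℝ)
      have h3 : Real.exp 2 = Real.exp 1 * Real.exp 1 := by rw [← Real.exp_add]; norm_num
      nlinarith
    calc (((θ / 2) ^ d)⁻¹ : ℝ) ^ m = (θ / 2)⁻¹ ^ (d * m) := by rw [← inv_pow, pow_mul]
      _ ≤ Real.exp 2 ^ (d * m) := by gcongr
      _ = Real.exp (2 * d * m) := by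
          rw [← Real.exp_nat_mul]
          push_cast
          ring_nf
  refine (card_monotone_fin_le _ _ (x := (θ / 2) ^ d) (by positivity)).trans ?_
  calc (((θ / 2) ^ d)⁻¹ : ℝ) ^ m * Real.exp ((θ / 2) ^ d * (↑(K * 2 ^ d + 2) + m))
      ≤ Real.exp (2 * d * m) * Real.exp ((θ / 2) ^ d * (↑(K * 2 ^ d + 2) + m)) := by gcongr
    _ = Real.exp (2 * d * m + (θ / 2) ^ d * (↑(K * 2 ^ d + 2) + m)) := (Real.exp_add _ _).symm
    _ ≤ Real.exp (K * ((4 + 2 * d) * θ ^ d)) := by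
        refine Real.exp_le_exp.2 ?_
        have h1 : 2 * (d : ℝ) * m ≤ 2 * d * (K * θ ^ d) := by gcongr
        have h2 : (θ / 2) ^ d * (K * 2 ^ d) = K * θ ^ d := by
          rw [div_pow]
          field_simp
        have h3 : (θ / 2) ^ d * m ≤ 1 * (K * θ ^ d) := by
          gcongr
          linarith
        push_cast
        linarith

/-- The supremum of `h` over the points where the distribution function of `Q` is below `c / n`. -/
noncomputable def quantileSup (Q : Measure ℝ) (h : ℝ → ℝ) (n c : ℕ) : ℝ :=
  ⨆ t, if n * cdf Q t < c then h t else 0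

section quantileSup

variable {Q : Measure ℝ} {h : ℝ → ℝ} (n : ℕ)

theorem bddAbove_quantileSup (h01 : ∀ t, h t ∈ Set.Icc (0 : ℝ) 1) (c : ℕ) :
    BddAbove (Set.range fun t => if n * cdf Q t < c then h t else 0) := by
  refine ⟨1, ?_⟩
  rintro _ ⟨t, rfl⟩
  simp only
  split_ifs
  exacts [(h01 t).2, zero_le_one]

theorem monotone_quantileSup (h01 : ∀ t, h t ∈ Set.Icc (0 : ℝ) 1) :
    Monotone (quantileSup Q h n) := by
  intro a b hab
  refine ciSup_mono (bddAbove_quantileSup n h01 b) fun t => ?_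
  have hab' : (a : ℝ) ≤ b := by exact_mod_cast hab
  have := (h01 t).1
  split_ifs <;> linarith

theorem quantileSup_mem_Icc (h01 : ∀ t, h t ∈ Set.Icc (0 : ℝ) 1) (c : ℕ) :
    quantileSup Q h n c ∈ Set.Icc (0 : ℝ) 1 := by
  have h0 := fun t => (h01 t).1
  have h1 := fun t => (h01 t).2
  refine ⟨Real.iSup_nonneg fun t => ?_, ciSup_le fun t => ?_⟩
  · split_ifs
    exacts [h0 t, le_rfl]
  · split_ifs
    exacts [h1 t, zero_le_one]

theorem quantileSup_floor_le (hmono : Monotone h) (h01 : ∀ t, h t ∈ Set.Icc (0 : ℝ) 1) (t : ℝ) :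
    quantileSup Q h n ⌊n * cdf Q t⌋₊ ≤ h t := by
  refine ciSup_le fun s => ?_
  split_ifs with hs
  · have hfloor := Nat.floor_le (mul_nonneg n.cast_nonneg (cdf_nonneg Q t))
    refine hmono (le_of_not_gt fun hts => ?_)
    have := mul_le_mul_of_nonneg_left (monotone_cdf Q hts.le) (n.cast_nonneg : (0 : ℝ) ≤ n)
    linarith
  · exact (h01 t).1

theorem le_quantileSup_floor_add_one (h01 : ∀ t, h t ∈ Set.Icc (0 : ℝ) 1) (t : ℝ) :
    h t ≤ quantileSup Q h n (⌊n * cdf Q t⌋₊ + 1) := by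
  refine le_ciSup_of_le (bddAbove_quantileSup n h01 _) t ?_
  rw [if_pos]
  push_cast
  exact Nat.lt_floor_add_one _

end quantileSup

theorem rpow_le_sum_of_le_oscillation {q W : ℝ} (hq : 1 ≤ q) (hW : 0 ≤ W) {D : ℕ} {η osc : ℕ → ℝ}
    (hη : ∀ d, 0 < η d) (hosc : ∀ d, 0 ≤ osc d) (hle : ∀ d ≤ D, W ≤ osc d + 2 * η d)
    (hD : osc D ≤ η D) :
    W ^ q ≤ (3 * η 0) ^ q + ∑ d ∈ Finset.range D, (3 * η (d + 1)) ^ q / η d * osc d := by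
  classical
  have hterm : ∀ d, 0 ≤ (3 * η (d + 1)) ^ q / η d * osc d := fun d => by
    have := hη d
    have := hη (d + 1)
    have := hosc d
    positivity
  have h0 : 0 ≤ (3 * η 0) ^ q := by
    have := hη 0
    positivity
  have hex : ∃ d, osc d ≤ η d := ⟨D, hD⟩
  have hspec := Nat.find_spec hex
  have hfindle : Nat.find hex ≤ D := Nat.find_min' hex hD
  have hmin : ∀ d < Nat.find hex, η d < osc d := fun d hd => not_le.1 (Nat.find_min hex hd)
  have hWle : W ^ q ≤ (3 * η (Nat.find hex)) ^ q := by
    have := hle _ hfindle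
    gcongr
    linarith
  refine hWle.trans ?_
  generalize Nat.find hex = k at *
  cases k with
  | zero => exact le_add_of_nonneg_right (Finset.sum_nonneg fun d _ => hterm d)
  | succ d =>
    have hsingle := Finset.single_le_sum (fun d _ => hterm d)
      (Finset.mem_range.2 (Nat.lt_of_succ_le hfindle))
    have hbig : (3 * η (d + 1)) ^ q ≤ (3 * η (d + 1)) ^ q / η d * osc d := by
      have h1 := hη d
      have h2 := hη (d + 1)
      rw [div_mul_eq_mul_div, le_div_iff₀ h1]
      gcongr
      exact (hmin d d.lt_succ_self).le
    linarith

theorem integrable_and_integral_le_of_le {α : Type*} [MeasurableSpace α] {μ : Measure α}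
    {f g : α → ℝ} {B : ℝ} (hf : Measurable f) (hf0 : ∀ x, 0 ≤ f x) (hfg : ∀ x, f x ≤ g x)
    (hg : Integrable g μ) (hB : ∫ x, g x ∂μ ≤ B) :
    Integrable f μ ∧ ∫ x, f x ∂μ ≤ B := by
  have h_integrable : Integrable f μ := hg.mono' hf.aestronglyMeasurable
    (ae_of_all _ fun x => by rw [Real.norm_of_nonneg (hf0 x)]; exact hfg x)
  exact ⟨h_integrable, (integral_mono h_integrable hg hfg).trans hB⟩

theorem exists_monotone_brackets {q : ℝ} (hq : 1 ≤ q) :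
    ∃ A > (0 : ℝ), ∃ B > (0 : ℝ), ∀ (Q : Measure ℝ) [IsProbabilityMeasure Q]
      [NullSingletonClass Q], ∀ ε ∈ Set.Ioo (0 : ℝ) 1,
      ∃ (ι : Type) (_ : Fintype ι) (L U : ι → ℝ → ℝ),
        (Fintype.card ι : ℝ) ≤ Real.exp (A / ε) ∧
        (∀ j, Measurable (L j)) ∧ (∀ j, Measurable (U j)) ∧
        ∀ h : ℝ → ℝ, Monotone h → (∀ t, h t ∈ Set.Icc (0 : ℝ) 1) →
          ∃ j, (∀ t, L j t ≤ h t ∧ h t ≤ U j t) ∧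
            Integrable (fun t => (U j t - L j t) ^ q) Q ∧
            ∫ t, (U j t - L j t) ^ q ∂Q ≤ B * ε ^ q := by
  have hq0 : 0 < q := by linarith
  set θ : ℝ := (1 / 2) ^ (1 / q) with hθdef
  have hθ0 : 0 < θ := by positivity
  have hθ1 : θ < 1 := Real.rpow_lt_one (by norm_num) (by norm_num) (by positivity)
  have hθhalf : 1 / 2 ≤ θ := by
    calc (1 / 2 : ℝ) = (1 / 2) ^ (1 : ℝ) := (Real.rpow_one _).symm
      _ ≤ θ := Real.rpow_le_rpow_of_exponent_ge (by norm_num) (by norm_num)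
          (by rw [div_le_one hq0]; exact hq)
  have hθq : θ ^ q = 1 / 2 := by
    rw [hθdef, ← Real.rpow_mul (by norm_num), one_div_mul_cancel hq0.ne', Real.rpow_one]
  have hθpow : ∀ d : ℕ, (θ ^ d) ^ q = (1 / 2) ^ d := fun d => by
    rw [← hθq, ← Real.rpow_natCast, ← Real.rpow_natCast, ← Real.rpow_mul hθ0.le,
      ← Real.rpow_mul hθ0.le, mul_comm]
  have hnorm : ‖θ‖ < 1 := by rwa [Real.norm_of_nonneg hθ0.le]
  have hsummable : Summable fun d : ℕ => (4 + 2 * (d : ℝ)) * θ ^ d := by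
    have h0 := (summable_geometric_of_lt_one hθ0.le hθ1).mul_left 4
    have h1 := (summable_pow_mul_geometric_of_norm_lt_one 1 hnorm).mul_left 2
    refine (h0.add h1).congr fun d => ?_
    ring
  set A : ℝ := ∑' d : ℕ, (4 + 2 * (d : ℝ)) * θ ^ d with hA
  have hA0 : 0 < A := hsummable.tsum_pos (fun d => by positivity) 0 (by norm_num)
  have hgap : 0 < 1 - θ := by linarith
  refine ⟨2 * A, by positivity, 3 ^ q * (1 + 2 * (1 - θ)⁻¹), by positivity, ?_⟩
  rintro Q _ _ ε ⟨hε0, hε1⟩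
  set K : ℕ := ⌈1 / ε⌉₊
  have hKε : 1 / ε ≤ K := Nat.le_ceil _
  have hK1 : (1 : ℝ) ≤ K := le_trans (by rw [le_div_iff₀ hε0]; linarith) hKε
  have hK0 : (0 : ℝ) < K := by linarith
  have hK1' : 1 ≤ K := by exact_mod_cast hK1
  have hK2 : (K : ℝ) ≤ 2 / ε := by
    have h1 : (K : ℝ) < 1 / ε + 1 := Nat.ceil_lt_add_one (by positivity)
    have h2 : 1 ≤ 1 / ε := by rw [le_div_iff₀ hε0]; linarith
    have h3 : 2 / ε = 1 / ε + 1 / ε := by ring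
    linarith
  have hKinv : (K : ℝ)⁻¹ ≤ ε := by
    rw [inv_le_comm₀ hK0 hε0]
    simpa using hKε
  obtain ⟨D, hD⟩ := exists_pow_lt_of_lt_one (inv_pos.2 hK0) hθ1
  set η : ℕ → ℝ := fun d => (K * θ ^ d)⁻¹ with hη
  have hη0 : ∀ d, 0 < η d := fun d => by positivity
  have hηD : 1 ≤ η D := by
    rw [hη, one_le_inv₀ (by positivity), ← le_div_iff₀' hK0, one_div]
    exact hD.le
  set n : ℕ → ℕ := fun d => K * 2 ^ d with hn
  have hn0 : ∀ d, 0 < n d := fun d => by positivity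
  set m : ℕ → ℕ := fun d => ⌊K * θ ^ d⌋₊
  let X : ℕ → Type := fun d => {u : Fin (n d + 2) → Fin (m d + 1) // Monotone u}
  classical
  let level : (∀ d : Fin (D + 1), X d) → Fin (D + 1) → ℕ → ℝ := fun j d c =>
    (((j d).1 (Fin.ofNat (n d + 2) c) : ℕ) : ℝ)
  let cell : ℕ → ℝ → ℕ := fun d t => ⌊n d * cdf Q t⌋₊
  have hcell : ∀ d, Measurable (cell d) := fun d =>
    ((monotone_cdf Q).measurable.const_mul _).nat_floor
  have hcellle : ∀ d t, cell d t ≤ n d := fun d t =>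
    Nat.floor_le_of_le (mul_le_of_le_one_right (Nat.cast_nonneg _) (cdf_le_one Q t))
  let low : (∀ d : Fin (D + 1), X d) → Fin (D + 1) → ℝ → ℝ := fun j d t =>
    η d * level j d (cell d t)
  let up : (∀ d : Fin (D + 1), X d) → Fin (D + 1) → ℝ → ℝ := fun j d t =>
    η d * (level j d (cell d t + 1) + 1)
  let L : (∀ d : Fin (D + 1), X d) → ℝ → ℝ := fun j =>
    Finset.univ.sup' Finset.univ_nonempty (low j)
  let U : (∀ d : Fin (D + 1), X d) → ℝ → ℝ := fun j =>
    Finset.univ.inf' Finset.univ_nonempty (up j)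
  have hL : ∀ j, Measurable (L j) := fun j => Finset.measurable_sup' _ fun d _ =>
    (measurable_from_top (f := fun c => η d * level j d c)).comp (hcell d)
  have hU : ∀ j, Measurable (U j) := fun j => 
    Finset.inf'_induction (p := Measurable) _ _ (fun _ hf _ hg => hf.inf hg) fun d _ =>
      (measurable_from_top (f := fun c => η d * (level j d (c + 1) + 1))).comp (hcell d)
  refine ⟨∀ d : Fin (D + 1), X d, inferInstance, L, U, ?_, hL, hU, ?_⟩
  · rw [Fintype.card_pi]
    push_cast
    calc ∏ d : Fin (D + 1), (Fintype.card (X d) : ℝ)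
        ≤ ∏ d : Fin (D + 1), Real.exp (K * ((4 + 2 * (d : ℕ)) * θ ^ (d : ℕ))) := by
          refine Finset.prod_le_prod (fun d _ => Nat.cast_nonneg _) fun d _ => ?_
          rw [← Nat.card_eq_fintype_card]
          exact card_monotone_geometric_le hK1' hθhalf hθ1
      _ = Real.exp (K * ∑ d : Fin (D + 1), (4 + 2 * ((d : ℕ) : ℝ)) * θ ^ (d : ℕ)) := by
          rw [← Real.exp_sum, Finset.mul_sum]
      _ ≤ Real.exp (2 * A / ε) := by
          refine Real.exp_le_exp.2 ?_
          rw [Fin.sum_univ_eq_sum_range fun d : ℕ => (4 + 2 * (d : ℝ)) * θ ^ d]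
          have hsum : ∑ d ∈ Finset.range (D + 1), (4 + 2 * (d : ℝ)) * θ ^ d ≤ A :=
            hsummable.sum_le_tsum _ fun d _ => by positivity
          calc K * ∑ d ∈ Finset.range (D + 1), (4 + 2 * (d : ℝ)) * θ ^ d
              ≤ 2 / ε * A := by gcongr
            _ = 2 * A / ε := by ring
  intro h hmono h01
  let w : ℕ → ℕ → ℝ := fun d => quantileSup Q h (n d)
  have hw : ∀ d, Monotone (w d) := fun d => monotone_quantileSup (n d) h01
  have hw01 : ∀ d c, w d c ∈ Set.Icc (0 : ℝ) 1 := fun d => quantileSup_mem_Icc (n d) h01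
  let j : ∀ d : Fin (D + 1), X d := fun d =>
    ⟨fun c => ⟨⌊w d c / η d⌋₊, by
      refine Nat.lt_succ_of_le (Nat.floor_le_floor ?_)
      rw [hη, div_inv_eq_mul]
      exact mul_le_of_le_one_left (by positivity) (hw01 d c).2⟩,
     fun a b hab => Fin.mk_le_mk.2 (Nat.floor_le_floor
       (div_le_div_of_nonneg_right (hw d hab) (hη0 d).le))⟩
  have hlevel : ∀ (d : Fin (D + 1)) c, c < n d + 2 → level j d c = ⌊w d c / η d⌋₊ := by
    intro d c hc
    simp only [level, j, Fin.val_ofNat, Nat.mod_eq_of_lt hc]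
  have hlow : ∀ d t, low j d t = η d * ⌊w d (cell d t) / η d⌋₊ := fun d t => by
    simp only [low]
    rw [hlevel d _ (by have := hcellle d t; omega)]
  have hup : ∀ d t, up j d t = η d * (⌊w d (cell d t + 1) / η d⌋₊ + 1) := fun d t => by
    simp only [up]
    rw [hlevel d _ (by have := hcellle d t; omega)]
  have hfloor : ∀ d c, η d * ⌊w d c / η d⌋₊ ≤ w d c := fun d c => by
    have := Nat.floor_le (div_nonneg (hw01 d c).1 (hη0 d).le)
    rwa [le_div_iff₀' (hη0 d)] at this
  have hfloor' : ∀ d c, w d c ≤ η d * (⌊w d c / η d⌋₊ + 1) := fun d c => by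
    have := (Nat.lt_floor_add_one (w d c / η d)).le
    rwa [div_le_iff₀' (hη0 d)] at this
  have hbracket : ∀ t, L j t ≤ h t ∧ h t ≤ U j t := by
    intro t
    simp only [L, U, Finset.sup'_apply, Finset.inf'_apply]
    refine ⟨Finset.sup'_le _ _ fun d _ => ?_, Finset.le_inf' _ _ fun d _ => ?_⟩
    · rw [hlow]
      exact (hfloor d _).trans (quantileSup_floor_le (n d) hmono h01 t)
    · rw [hup]
      exact (le_quantileSup_floor_add_one (n d) h01 t).trans (hfloor' d _)
  let osc : ℕ → ℝ → ℝ := fun d t => w d (cell d t + 1) - w d (cell d t)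
  have hosc0 : ∀ d t, 0 ≤ osc d t := fun d t => sub_nonneg.2 (hw d (Nat.le_succ _))
  have hoscint : ∀ d, Integrable (osc d) Q ∧ ∫ t, osc d t ∂Q ≤ 1 / n d := fun d =>
    integral_quantile_step_le Q (hn0 d) (hw d) (hw01 d)
  have hwidth : ∀ t, ∀ d ≤ D, U j t - L j t ≤ osc d t + 2 * η d := by
    intro t d hd
    have hUle : U j t ≤ up j ⟨d, Nat.lt_succ_of_le hd⟩ t := by
      simp only [U, Finset.inf'_apply]
      exact Finset.inf'_le (fun d => up j d t) (Finset.mem_univ _)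
    have hLle : low j ⟨d, Nat.lt_succ_of_le hd⟩ t ≤ L j t := by
      simp only [L, Finset.sup'_apply]
      exact Finset.le_sup' (fun d => low j d t) (Finset.mem_univ _)
    rw [hup] at hUle
    rw [hlow] at hLle
    have h1 := hfloor d (cell d t + 1)
    have h2 := hfloor' d (cell d t)
    simp only [osc]
    simp only at hUle hLle
    linarith
  have hwidth0 : ∀ t, 0 ≤ U j t - L j t := fun t => by
    linarith [(hbracket t).1, (hbracket t).2]
  have hsumint : ∀ d ∈ Finset.range D,
      Integrable (fun t => (3 * η (d + 1)) ^ q / η d * osc d t) Q := fun d _ =>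
    (hoscint d).1.const_mul _
  refine ⟨j, hbracket, integrable_and_integral_le_of_le
    (g := fun t => (3 * η 0) ^ q + ∑ d ∈ Finset.range D, (3 * η (d + 1)) ^ q / η d * osc d t)
    (((hU j).sub (hL j)).pow_const q) (fun t => Real.rpow_nonneg (hwidth0 t) q) (fun t => ?_)
    ((integrable_const _).add (integrable_finsetSum _ hsumint)) ?_⟩
  · refine rpow_le_sum_of_le_oscillation hq (hwidth0 t) hη0 (fun d => hosc0 d t) (hwidth t) ?_
    refine le_trans ?_ hηD
    linarith [(hw01 D (cell D t + 1)).2, (hw01 D (cell D t)).1]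
  rw [integral_add (integrable_const _) (integrable_finsetSum _ hsumint),
    integral_finsetSum _ hsumint, integral_const, probReal_univ, one_smul]
  have hscale : ∀ d, (3 * η d) ^ q = 3 ^ q * (K : ℝ)⁻¹ ^ q * 2 ^ d := by
    intro d
    simp only [hη]
    rw [mul_inv, Real.mul_rpow (by norm_num) (by positivity),
      Real.mul_rpow (by positivity) (by positivity), Real.inv_rpow (pow_nonneg hθ0.le d) q, hθpow]
    simp
    ring
  have hterm : ∀ d ∈ Finset.range D, ∫ t, (3 * η (d + 1)) ^ q / η d * osc d t ∂Q ≤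
      3 ^ q * (K : ℝ)⁻¹ ^ q * 2 * θ ^ d := by
    intro d _
    rw [integral_const_mul]
    calc (3 * η (d + 1)) ^ q / η d * ∫ t, osc d t ∂Q
        ≤ (3 * η (d + 1)) ^ q / η d * (1 / n d) := by
          have := hη0 d
          have := hη0 (d + 1)
          gcongr
          exact (hoscint d).2
      _ = 3 ^ q * (K : ℝ)⁻¹ ^ q * 2 * θ ^ d := by
          rw [hscale]
          simp only [hη, hn]
          push_cast
          field_simp
          ring
  have hgeom : ∑ d ∈ Finset.range D, θ ^ d ≤ (1 - θ)⁻¹ := by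
    rw [← tsum_geometric_of_lt_one hθ0.le hθ1]
    exact (summable_geometric_of_lt_one hθ0.le hθ1).sum_le_tsum _ fun d _ => by positivity
  calc (3 * η 0) ^ q + ∑ d ∈ Finset.range D, ∫ t, (3 * η (d + 1)) ^ q / η d * osc d t ∂Q
      ≤ 3 ^ q * (K : ℝ)⁻¹ ^ q * 2 ^ 0 +
          ∑ d ∈ Finset.range D, 3 ^ q * (K : ℝ)⁻¹ ^ q * 2 * θ ^ d :=
        add_le_add (hscale 0).le (Finset.sum_le_sum hterm)
    _ = 3 ^ q * (1 + 2 * ∑ d ∈ Finset.range D, θ ^ d) * (K : ℝ)⁻¹ ^ q := by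
        rw [← Finset.mul_sum]
        ring
    _ ≤ 3 ^ q * (1 + 2 * (1 - θ)⁻¹) * ε ^ q := by gcongr

theorem add_rpow_le_two_rpow_mul {q x y : ℝ} (hq : 0 ≤ q) (hx : 0 ≤ x) (hy : 0 ≤ y) :
    (x + y) ^ q ≤ 2 ^ q * (x ^ q + y ^ q) := by
  have hmax : 0 ≤ max x y := le_max_of_le_left hx
  calc (x + y) ^ q ≤ (2 * max x y) ^ q := by
        gcongr
        linarith [le_max_left x y, le_max_right x y]
    _ = 2 ^ q * max x y ^ q := Real.mul_rpow (by norm_num) hmax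
    _ ≤ 2 ^ q * (x ^ q + y ^ q) := by
        have h1 := Real.rpow_nonneg hx q
        have h2 := Real.rpow_nonneg hy q
        gcongr
        rcases max_choice x y with h | h <;> rw [h] <;> linarith

theorem exists_monotone_comp_brackets {q M : ℝ} (hq : 1 ≤ q) (hM : 0 < M) :
    ∃ A > (0 : ℝ), ∃ B > (0 : ℝ), ∀ (S : Type) [MeasurableSpace S] (μ : Measure S)
      [IsProbabilityMeasure μ] (l₀ : S → ℝ), Measurable l₀ →
      (∀ E : Set ℝ, MeasurableSet E → μ.map l₀ E ≤ ENNReal.ofReal M * volume E) →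
      ∀ ε ∈ Set.Ioo (0 : ℝ) 1,
      ∃ (ι : Type) (_ : Fintype ι) (L U : ι → S → ℝ),
        (Fintype.card ι : ℝ) ≤ Real.exp (A / ε) ∧
        (∀ j, Measurable (L j)) ∧ (∀ j, Measurable (U j)) ∧
        ∀ h : ℝ → ℝ, Monotone h → (∀ t, h t ∈ Set.Icc (0 : ℝ) 1) →
          ∃ j, (∀ l : S → ℝ, (∀ s, |l s - l₀ s| ≤ 2 * ε ^ q) →
              ∀ s, L j s ≤ h (l s) ∧ h (l s) ≤ U j s) ∧
            (∀ s, L j s ≤ U j s) ∧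
            Integrable (fun s => (U j s - L j s) ^ q) μ ∧
            ∫ s, (U j s - L j s) ^ q ∂μ ≤ B * ε ^ q := by
  have hq0 : 0 ≤ q := by linarith
  obtain ⟨A, hA, B, hB, hbrackets⟩ := exists_monotone_brackets hq
  refine ⟨2 * A, by positivity, 2 ^ q * (2 ^ q * (B + 4 * M) + B), by positivity, ?_⟩
  intro S _ μ _ l₀ hl₀ hdens ε hε
  have hεq : 0 < ε ^ q := Real.rpow_pos_of_pos hε.1 q
  set δ : ℝ := 2 * ε ^ q with hδ
  have hδ0 : 0 ≤ δ := by positivity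
  have : IsProbabilityMeasure (μ.map l₀) := Measure.isProbabilityMeasure_map hl₀.aemeasurable
  have : NullSingletonClass (μ.map l₀) :=
    ⟨fun x => by simpa using hdens {x} (measurableSet_singleton x)⟩
  obtain ⟨ι, _, L, U, hcard, hL, hU, hbracket⟩ := hbrackets (μ.map l₀) ε hε
  refine ⟨ι × ι, inferInstance, fun j s => L j.1 (l₀ s), fun j s => U j.2 (l₀ s), ?_,
    fun j => (hL j.1).comp hl₀, fun j => (hU j.2).comp hl₀, ?_⟩
  · rw [Fintype.card_prod]
    push_cast
    calc (Fintype.card ι : ℝ) * Fintype.card ι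
        ≤ Real.exp (A / ε) * Real.exp (A / ε) := by gcongr
      _ = Real.exp (2 * A / ε) := by
          rw [← Real.exp_add]
          ring_nf
  intro h hmono h01
  have hsub : Monotone fun t => h (t - δ) := fun a b hab => hmono (by linarith)
  have hadd : Monotone fun t => h (t + δ) := fun a b hab => hmono (by linarith)
  obtain ⟨i, hi, hi_int, hi_le⟩ := hbracket _ hsub fun t => h01 _
  obtain ⟨k, hk, hk_int, hk_le⟩ := hbracket _ hadd fun t => h01 _
  have hgap : ∀ t, 0 ≤ h (t + δ) - h (t - δ) := fun t => sub_nonneg.2 (hmono (by linarith))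
  have hgap1 : ∀ t, h (t + δ) - h (t - δ) ≤ 1 := fun t => by
    linarith [(h01 (t + δ)).2, (h01 (t - δ)).1]
  have hgap_int : Integrable (fun t => h (t + δ) - h (t - δ)) (μ.map l₀) :=
    (integrable_const (1 : ℝ)).mono' (hadd.measurable.sub hsub.measurable).aestronglyMeasurable
      (ae_of_all _ fun t => by rw [Real.norm_of_nonneg (hgap t)]; exact hgap1 t)
  have hgap_le := integral_shift_sub_shift_le (μ.map l₀) hM.le hδ0 hdens hmono h01
  have hle : ∀ t, L i t ≤ U k t := fun t => by linarith [(hi t).1, (hk t).2, hgap t]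
  have hwidth : ∀ t, (U k t - L i t) ^ q ≤
      2 ^ q * (2 ^ q * ((U k t - L k t) ^ q + (h (t + δ) - h (t - δ))) +
        (U i t - L i t) ^ q) := by
    intro t
    have hwi : 0 ≤ U i t - L i t := by linarith [(hi t).1, (hi t).2]
    have hwk : 0 ≤ U k t - L k t := by linarith [(hk t).1, (hk t).2]
    have hpow : (h (t + δ) - h (t - δ)) ^ q ≤ h (t + δ) - h (t - δ) := by
      simpa using Real.rpow_le_rpow_of_exponent_ge' (hgap t) (hgap1 t) zero_le_one hq
    calc (U k t - L i t) ^ q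
        ≤ ((U k t - L k t) + (h (t + δ) - h (t - δ)) + (U i t - L i t)) ^ q := by
          have := hle t
          gcongr
          linarith [(hi t).2, (hk t).1]
      _ ≤ 2 ^ q * (((U k t - L k t) + (h (t + δ) - h (t - δ))) ^ q + (U i t - L i t) ^ q) :=
          add_rpow_le_two_rpow_mul hq0 (add_nonneg hwk (hgap t)) hwi
      _ ≤ 2 ^ q * (2 ^ q * ((U k t - L k t) ^ q + (h (t + δ) - h (t - δ)) ^ q) +
            (U i t - L i t) ^ q) := by
          gcongr
          exact add_rpow_le_two_rpow_mul hq0 hwk (hgap t)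
      _ ≤ _ := by gcongr
  have hmeas : Measurable fun t => (U k t - L i t) ^ q := ((hU k).sub (hL i)).pow_const q
  have hsum_int := hk_int.add hgap_int
  have key := integrable_and_integral_le_of_le (μ := μ.map l₀)
    (B := 2 ^ q * (2 ^ q * (B + 4 * M) + B) * ε ^ q)
    hmeas (fun t => Real.rpow_nonneg (sub_nonneg.2 (hle t)) q) hwidth
    (((hsum_int.const_mul _).add hi_int).const_mul _) (by
      rw [integral_const_mul]
      erw [integral_add (hsum_int.const_mul _) hi_int]
      rw [integral_const_mul]
      erw [integral_add hk_int hgap_int]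
      calc _ ≤ 2 ^ q * (2 ^ q * (B * ε ^ q + 2 * δ * M) + B * ε ^ q) := by gcongr
        _ = _ := by rw [hδ]; ring)
  refine ⟨(i, k), fun l hl s => ?_, fun s => hle (l₀ s), ?_, ?_⟩
  · obtain ⟨h1, h2⟩ := abs_le.1 (hl s)
    exact ⟨(hi (l₀ s)).1.trans (hmono (by linarith)), le_trans (hmono (by linarith)) (hk (l₀ s)).2⟩
  · exact (integrable_map_measure hmeas.aestronglyMeasurable hl₀.aemeasurable).1 key.1
  · rw [integral_map hl₀.aemeasurable hmeas.aestronglyMeasurable] at key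
    exact key.2

theorem exists_boundedVariation_comp_brackets {q M : ℝ} (hq : 1 ≤ q) (hM : 0 < M) :
    ∃ C₁ > (0 : ℝ), ∃ C₂ > (0 : ℝ), ∀ (S : Type) [MeasurableSpace S] (μ : Measure S)
      [IsProbabilityMeasure μ] (l₀ : S → ℝ), Measurable l₀ →
      (∀ E : Set ℝ, MeasurableSet E → μ.map l₀ E ≤ ENNReal.ofReal M * volume E) →
      ∀ ε ∈ Set.Ioo (0 : ℝ) 1,
      ∃ g Δ : Fin ⌈Real.exp (C₁ / ε)⌉₊ → S → ℝ,
        (∀ j, Measurable (Δ j)) ∧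
        ∀ τ : ℝ → ℝ, (∀ t, τ t ∈ Set.Icc (-M) M) →
          eVariationOn τ Set.univ ≤ ENNReal.ofReal M →
          ∀ l : S → ℝ, (∀ s, |l s - l₀ s| ≤ 2 * ε ^ q) →
          ∃ j, (∀ s, |τ (l s) - g j s| ≤ Δ j s) ∧
            Integrable (fun s => Δ j s ^ q) μ ∧
            (∫ s, Δ j s ^ q ∂μ) ^ (1 / q) ≤ C₂ * ε := by
  have hq0 : 0 < q := by linarith
  obtain ⟨A, hA, B, hB, hbrackets⟩ := exists_monotone_comp_brackets hq hM
  set C : ℝ := (3 * M) ^ q * (2 ^ q * (2 * B)) with hC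
  have hC0 : 0 < C := by positivity
  refine ⟨2 * A, by positivity, C ^ (1 / q), by positivity, ?_⟩
  intro S _ μ _ l₀ hl₀ hdens ε hε
  have hεq : 0 < ε ^ q := Real.rpow_pos_of_pos hε.1 q
  obtain ⟨ι, _, L, U, hcard, hL, hU, hbracket⟩ := hbrackets S μ l₀ hl₀ hdens ε hε
  obtain ⟨j₀, -⟩ := hbracket (fun _ => 0) monotone_const fun _ => by simp
  have : Nonempty (ι × ι) := ⟨(j₀, j₀)⟩
  have hcard' : Fintype.card (ι × ι) ≤ Fintype.card (Fin ⌈Real.exp (2 * A / ε)⌉₊) := by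
    have hsq : ((Fintype.card (ι × ι) : ℕ) : ℝ) ≤ Real.exp (2 * A / ε) := by
      rw [Fintype.card_prod]
      push_cast
      calc (Fintype.card ι : ℝ) * Fintype.card ι
          ≤ Real.exp (A / ε) * Real.exp (A / ε) := by gcongr
        _ = Real.exp (2 * A / ε) := by
            rw [← Real.exp_add]
            ring_nf
    rw [Fintype.card_fin]
    exact_mod_cast hsq.trans (Nat.le_ceil _)
  obtain ⟨emb⟩ := Function.Embedding.nonempty_of_card_le hcard'
  have hsurj := Function.invFun_surjective emb.injective
  set e := Function.invFun emb
  refine ⟨fun j s => 3 * M * (L (e j).1 s - U (e j).2 s) + M,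
    fun j s => 3 * M * ((U (e j).1 s - L (e j).1 s) + (U (e j).2 s - L (e j).2 s)),
    fun j => (((hU _).sub (hL _)).add ((hU _).sub (hL _))).const_mul _, ?_⟩
  intro τ hτ hvar l hl
  obtain ⟨f, g, hf, hg, hf01, hg01, hτfg⟩ := exists_jordan_decomposition hM hτ hvar
  obtain ⟨i, hi, hi0, hi_int, hi_le⟩ := hbracket f hf hf01
  obtain ⟨k, hk, hk0, hk_int, hk_le⟩ := hbracket g hg hg01
  obtain ⟨j, hj⟩ := hsurj (i, k)
  refine ⟨j, ?_⟩
  simp only [hj]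
  have hi0' := fun s => sub_nonneg.2 (hi0 s)
  have hk0' := fun s => sub_nonneg.2 (hk0 s)
  refine ⟨fun s => ?_, ?_⟩
  · obtain ⟨h1, h2⟩ := hi l hl s
    obtain ⟨h3, h4⟩ := hk l hl s
    have hsplit : τ (l s) - (3 * M * (L i s - U k s) + M) =
        3 * M * ((f (l s) - L i s) + (U k s - g (l s))) := by
      rw [hτfg]
      ring
    rw [hsplit, abs_of_nonneg (mul_nonneg (by positivity) (by linarith))]
    gcongr
  have hnonneg : ∀ s, 0 ≤ 3 * M * ((U i s - L i s) + (U k s - L k s)) := fun s =>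
    mul_nonneg (by positivity) (add_nonneg (hi0' s) (hk0' s))
  have key := integrable_and_integral_le_of_le (μ := μ) (B := C * ε ^ q)
    (f := fun s => (3 * M * ((U i s - L i s) + (U k s - L k s))) ^ q)
    (g := fun s => (3 * M) ^ q * (2 ^ q * ((U i s - L i s) ^ q + (U k s - L k s) ^ q)))
    (((((hU i).sub (hL i)).add ((hU k).sub (hL k))).const_mul _).pow_const q)
    (fun s => Real.rpow_nonneg (hnonneg s) q)
    (fun s => by
      rw [Real.mul_rpow (by positivity) (add_nonneg (hi0' s) (hk0' s))]
      gcongr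
      exact add_rpow_le_two_rpow_mul hq0.le (hi0' s) (hk0' s))
    (((hi_int.add hk_int).const_mul _).const_mul _) (by
      rw [integral_const_mul, integral_const_mul, integral_add hi_int hk_int]
      calc _ ≤ (3 * M) ^ q * (2 ^ q * (B * ε ^ q + B * ε ^ q)) := by gcongr
        _ = _ := by rw [hC]; ring)
  refine ⟨key.1, ?_⟩
  calc (∫ s, (3 * M * ((U i s - L i s) + (U k s - L k s))) ^ q ∂μ) ^ (1 / q)
      ≤ (C * ε ^ q) ^ (1 / q) := by
        have h0 : 0 ≤ ∫ s, (3 * M * ((U i s - L i s) + (U k s - L k s))) ^ q ∂μ :=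
          integral_nonneg fun s => Real.rpow_nonneg (hnonneg s) q
        have h1 := key.2
        gcongr
    _ = C ^ (1 / q) * ε := by
        rw [Real.mul_rpow hC0.le hεq.le, ← Real.rpow_mul hε.1.le, mul_one_div_cancel hq0.ne',
          Real.rpow_one]

/-- Lemma A1 of the paper: a bracketing bound for the class
`𝒢 = {τ∘λ : τ ∈ 𝒯, λ ∈ Λ}`, where each `λ ∈ Λ` has pushforward density bounded by `M`
and each `τ ∈ 𝒯` is a `[−M,M]`-valued function of bounded variation (≤ M).
There are constants `C₁, C₂ > 0` depending only on `q` and `M` such that an `ε^q`-net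
of `Λ` of size `N` in sup-norm yields an `L_q(μ)`-bracketing family for `𝒢` of size
`N·⌈exp(C₁/ε)⌉` at radius `C₂·ε`. -/
theorem stmt7 (q M : ℝ) (hq : 1 ≤ q) (hM : 0 < M) :
    ∃ C₁ > (0:ℝ), ∃ C₂ > (0:ℝ),
      ∀ (S : Type) [MeasurableSpace S] (μ : Measure S) [IsProbabilityMeasure μ]
        (Λ : Set (S → ℝ)) (T : Set (ℝ → ℝ)),
        (∀ l ∈ Λ, Measurable l ∧
          ∀ A : Set ℝ, MeasurableSet A → μ.map l A ≤ ENNReal.ofReal M * volume A) →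
        (∀ τ ∈ T, (∀ t, τ t ∈ Set.Icc (-M) M) ∧
          eVariationOn τ Set.univ ≤ ENNReal.ofReal M) →
        ∀ ε ∈ Set.Ioo (0:ℝ) 1,
        ∀ (N : ℕ) (Λ₀ : Fin N → S → ℝ),
          (∀ l ∈ Λ, ∃ i, ∀ s, |l s - Λ₀ i s| ≤ ε ^ q) →
          ∃ g Δ : Fin (N * ⌈Real.exp (C₁ / ε)⌉₊) → S → ℝ,
            (∀ j, Measurable (Δ j)) ∧
            ∀ τ ∈ T, ∀ l ∈ Λ, ∃ j,
              (∀ s, |τ (l s) - g j s| ≤ Δ j s) ∧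
              Integrable (fun s => Δ j s ^ q) μ ∧
              (∫ s, Δ j s ^ q ∂μ) ^ (1/q) ≤ C₂ * ε := by
  obtain ⟨C₁, hC₁, C₂, hC₂, hbrackets⟩ := exists_boundedVariation_comp_brackets hq hM
  refine ⟨C₁, hC₁, C₂, hC₂, ?_⟩
  intro S _ μ _ Λ T hΛ hT ε hε N Λ₀ hnet
  have hlocal : ∀ i : Fin N, ∃ g Δ : Fin ⌈Real.exp (C₁ / ε)⌉₊ → S → ℝ,
      (∀ j, Measurable (Δ j)) ∧
      ∀ τ ∈ T, ∀ l ∈ Λ, (∀ s, |l s - Λ₀ i s| ≤ ε ^ q) → ∃ j,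
        (∀ s, |τ (l s) - g j s| ≤ Δ j s) ∧
        Integrable (fun s => Δ j s ^ q) μ ∧
        (∫ s, Δ j s ^ q ∂μ) ^ (1 / q) ≤ C₂ * ε := by
    intro i
    by_cases hex : ∃ l₀ ∈ Λ, ∀ s, |l₀ s - Λ₀ i s| ≤ ε ^ q
    · obtain ⟨l₀, hl₀, hclose₀⟩ := hex
      obtain ⟨g, Δ, hΔ, hcover⟩ := hbrackets S μ l₀ (hΛ l₀ hl₀).1 (hΛ l₀ hl₀).2 ε hε
      refine ⟨g, Δ, hΔ, fun τ hτ l _ hclose => hcover τ (hT τ hτ).1 (hT τ hτ).2 l fun s => ?_⟩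
      have htri := abs_sub_le (l s) (Λ₀ i s) (l₀ s)
      have h1 := hclose s
      have h2 := hclose₀ s
      rw [abs_sub_comm] at h2
      linarith
    · exact ⟨0, 0, fun _ => measurable_const, fun τ _ l hl hclose =>
        (hex ⟨l, hl, hclose⟩).elim⟩
  choose g Δ hΔ hcover using hlocal
  refine ⟨fun j => g (finProdFinEquiv.symm j).1 (finProdFinEquiv.symm j).2,
    fun j => Δ (finProdFinEquiv.symm j).1 (finProdFinEquiv.symm j).2, fun j => hΔ _ _, ?_⟩
  intro τ hτ l hl
  obtain ⟨i, hi⟩ := hnet l hl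
  obtain ⟨j, hj⟩ := hcover i τ hτ l hl hi
  refine ⟨finProdFinEquiv (i, j), ?_⟩
  simpa only [Equiv.symm_apply_apply] using hj
end

section
/- Corollary A1: There exist constants C₁, C₂ > 0 depending only on q and M with the following property. For every n ∈ ℕ and every ε ∈ (0,1): if there is a finite set Λ₀ of functions S → ℝ of cardinality N such that each λ ∈ Λ admits λ' ∈ Λ₀ with sup_{s∈S} |λ(s) − λ'(s)| ≤ ε^q, then there exists a finite family of pairs (g_j, Δ_j)_{j ≤ N·⌈exp(C₁/ε)⌉} of measurable functions on S such that every member b ∈ 𝓑_n has an index j with |b(s) − g_j(s)| ≤ Δ_j(s) for all s ∈ S and (∫ Δ_j^q dμ)^{1/q} ≤ C₂·ε. -/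
open MeasureTheory

lemma measure_cdf_mem_Ico_le (ν : Measure ℝ) [IsProbabilityMeasure ν] [NullSingletonClass ν]
    (a b : ℝ) :
    ν {y | a ≤ ProbabilityTheory.cdf ν y ∧ ProbabilityTheory.cdf ν y < b} ≤
      ENNReal.ofReal (b - a) := by
  have hG : Measurable (ProbabilityTheory.cdf ν) := (ProbabilityTheory.monotone_cdf ν).measurable
  have hA : MeasurableSet {y | a ≤ ProbabilityTheory.cdf ν y ∧ ProbabilityTheory.cdf ν y < b} :=
    (measurableSet_le measurable_const hG).inter (measurableSet_lt hG measurable_const)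
  rw [hA.measure_eq_iSup_isCompact]
  refine iSup₂_le fun K hKA => iSup_le fun hK => ?_
  rcases K.eq_empty_or_nonempty with rfl | hne
  · simp
  obtain ⟨x, hx, hxm⟩ := hK.exists_isLeast hne
  obtain ⟨y, hy, hym⟩ := hK.exists_isGreatest hne
  have hsub : K ⊆ Set.Icc x y := fun z hz => ⟨hxm hz, hym hz⟩
  calc ν K ≤ ν (Set.Icc x y) := measure_mono hsub
    _ = ν (Set.Ioc x y) := (measure_congr Ioc_ae_eq_Icc).symm
    _ = ENNReal.ofReal (ProbabilityTheory.cdf ν y - ProbabilityTheory.cdf ν x) := by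
        conv_lhs => rw [← ProbabilityTheory.measure_cdf ν]
        exact StieltjesFunction.measure_Ioc _ _ _
    _ ≤ _ := ENNReal.ofReal_le_ofReal (by linarith [(hKA hx).1, (hKA hy).2])

lemma Monotone.card_filter_ne_succ_add_le {f : ℕ → ℕ} (hf : Monotone f) (n : ℕ) :
    ((Finset.range n).filter fun i => f i ≠ f (i + 1)).card + f 0 ≤ f n := by
  induction n with
  | zero => simp
  | succ n ih =>
    have h := hf n.le_succ
    rw [Finset.range_add_one, Finset.filter_insert]
    split_ifs with h'
    · rw [Finset.card_insert_of_notMem (by simp)]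
      have : f n < f (n + 1) := lt_of_le_of_ne h h'
      omega
    · exact ih.trans h

lemma card_orderHom_fin_le (a R : ℕ) :
    Nat.card (Fin a →o Fin (R + 1)) ≤ (R + a).choose R := by
  classical
  have : Finite (Fin a →o Fin (R + 1)) := DFunLike.finite _
  have := Fintype.ofFinite (Fin a →o Fin (R + 1))
  let φ : (Fin a →o Fin (R + 1)) → Fin a → Fin (R + a) := fun f i =>
    ⟨(f i : ℕ) + i, by have := (f i).2; have := i.2; omega⟩
  have hφ : ∀ f, StrictMono (φ f) := fun f i j hij => by
    have h1 : f i ≤ f j := f.monotone hij.le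
    have h1 : (f i : ℕ) ≤ f j := h1
    have h2 : (i : ℕ) < j := hij
    change (f i : ℕ) + i < (f j : ℕ) + j
    omega
  have hinj : Function.Injective fun f => Finset.univ.image (φ f) := fun f g hfg => by
    have h : Set.range (φ f) = Set.range (φ g) := by
      have := congrArg (fun s : Finset (Fin (R + a)) => (s : Set (Fin (R + a)))) hfg
      simpa using this
    have h' := ((hφ f).range_inj (hφ g)).1 h
    ext i
    have := congrArg Fin.val (congrFun h' i)
    simp only [φ] at this
    omega
  rw [Nat.card_eq_fintype_card]
  calc Fintype.card (Fin a →o Fin (R + 1))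
      = (Finset.univ.image fun f => Finset.univ.image (φ f)).card := by
        rw [Finset.card_image_of_injective _ hinj, Finset.card_univ]
    _ ≤ (Finset.powersetCard a (Finset.univ : Finset (Fin (R + a)))).card := by
        refine Finset.card_le_card fun s hs => ?_
        obtain ⟨f, -, rfl⟩ := Finset.mem_image.1 hs
        rw [Finset.mem_powersetCard]
        exact ⟨Finset.subset_univ _, by
          rw [Finset.card_image_of_injective _ (hφ f).injective, Finset.card_univ,
            Fintype.card_fin]⟩
    _ = (R + a).choose R := by
        rw [Finset.card_powersetCard, Finset.card_univ, Fintype.card_fin, Nat.choose_symm_add]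

lemma exists_level_code (ν : Measure ℝ) [IsProbabilityMeasure ν] [NullSingletonClass ν] {m : ℕ} (hm : 0 < m)
    (R : ℕ) {η : ℝ} (hη : 0 < η) (hR : 1 < η * (R + 1)) :
    ∃ (T : Type) (_ : Finite T) (bad : T → Set ℝ) (low : T → ℝ → ℝ),
      Nat.card T ≤ (R + (m + 2)).choose R ∧ (∀ t, MeasurableSet (bad t)) ∧
      (∀ t, Measurable (low t)) ∧ (∀ t, ν (bad t) ≤ ENNReal.ofReal (R / m)) ∧
      (R = 0 → ∀ t, bad t = ∅) ∧
      ∀ A : ℝ → ℝ, Monotone A → (∀ y, A y ∈ Set.Icc (0 : ℝ) 1) →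
        ∃ t, ∀ y ∉ bad t, low t y ≤ A y ∧ A y ≤ low t y + η := by
  classical
  have hm' : (0 : ℝ) < m := by exact_mod_cast hm
  let G := ProbabilityTheory.cdf ν
  have hGmono : Monotone G := ProbabilityTheory.monotone_cdf ν
  let c : ℝ → ℕ := fun y => ⌊(m : ℝ) * G y⌋₊
  have hcmono : Monotone c := fun x y h =>
    Nat.floor_mono (mul_le_mul_of_nonneg_left (hGmono h) hm'.le)
  have hcm : Measurable c := hcmono.measurable
  have hcle : ∀ y, c y ≤ m := fun y => by
    apply Nat.floor_le_of_le
    have : G y ≤ 1 := ProbabilityTheory.cdf_le_one ν y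
    nlinarith
  have hcell : ∀ i : ℕ, ν (c ⁻¹' {i}) ≤ ENNReal.ofReal (1 / m) := fun i => by
    refine le_trans (measure_mono ?_)
      ((measure_cdf_mem_Ico_le ν (i / m) ((i + 1) / m)).trans_eq (by congr 1; ring))
    intro y hy
    have hy : c y = i := hy
    have h0 : 0 ≤ (m : ℝ) * G y := mul_nonneg hm'.le (ProbabilityTheory.cdf_nonneg ν y)
    obtain ⟨h1, h2⟩ := (Nat.floor_eq_iff h0).1 hy
    exact ⟨by rw [div_le_iff₀ hm']; linarith, by rw [lt_div_iff₀ hm']; linarith⟩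
  let e : (Fin (m + 2) →o Fin (R + 1)) → ℕ → ℕ := fun t i => t ⟨min i (m + 1), by omega⟩
  have hemono : ∀ t, Monotone (e t) := fun t i j hij => by
    have : t ⟨min i (m + 1), by omega⟩ ≤ t ⟨min j (m + 1), by omega⟩ :=
      t.monotone (by simp only [Fin.mk_le_mk]; omega)
    exact this
  have hele : ∀ t i, e t i ≤ R := fun t i => Nat.lt_succ_iff.1 (t _).2
  refine ⟨Fin (m + 2) →o Fin (R + 1), DFunLike.finite _, fun t => {y | e t (c y) ≠ e t (c y + 1)},
    fun t y => η * e t (c y), card_orderHom_fin_le _ _, fun t => ?_, fun t => ?_, fun t => ?_,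
    fun h0 t => ?_, fun A hA hA01 => ?_⟩
  · exact hcm (MeasurableSet.of_discrete (s := {i : ℕ | e t i ≠ e t (i + 1)}))
  · exact (measurable_of_countable (fun i : ℕ => η * (e t i : ℝ))).comp hcm
  · let B := (Finset.range (m + 1)).filter fun i => e t i ≠ e t (i + 1)
    have hB : B.card ≤ R := by
      have := (hemono t).card_filter_ne_succ_add_le (m + 1)
      have := hele t (m + 1)
      simp only [B]; omega
    have hsub : {y | e t (c y) ≠ e t (c y + 1)} ⊆ ⋃ i ∈ B, c ⁻¹' {i} := fun y hy => by
      simp only [Set.mem_iUnion]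
      exact ⟨c y, Finset.mem_filter.2 ⟨Finset.mem_range.2 (Nat.lt_succ_of_le (hcle y)), hy⟩, rfl⟩
    calc ν _ ≤ ν (⋃ i ∈ B, c ⁻¹' {i}) := measure_mono hsub
      _ ≤ ∑ i ∈ B, ν (c ⁻¹' {i}) := measure_biUnion_finset_le _ _
      _ ≤ ∑ i ∈ B, ENNReal.ofReal (1 / m) := Finset.sum_le_sum fun i _ => hcell i
      _ = ENNReal.ofReal (B.card * (1 / m)) := by
        rw [Finset.sum_const, nsmul_eq_mul, ENNReal.ofReal_mul (by positivity),
          ENNReal.ofReal_natCast]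
      _ ≤ _ := by
        refine ENNReal.ofReal_le_ofReal ?_
        rw [mul_one_div]
        gcongr
  · refine Set.eq_empty_iff_forall_notMem.2 fun y hy => hy ?_
    have h1 := hele t (c y)
    have h2 := hele t (c y + 1)
    omega
  · let σ : ℕ → ℝ := fun i => ⨆ y, if c y < i then A y else 0
    have hbdd : ∀ i, BddAbove (Set.range fun y => if c y < i then A y else 0) := fun i =>
      ⟨1, by rintro _ ⟨y, rfl⟩; dsimp only; split_ifs; exacts [(hA01 y).2, zero_le_one]⟩
    have hσ1 : ∀ i, σ i ≤ 1 := fun i => ciSup_le fun y => by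
      split_ifs; exacts [(hA01 y).2, zero_le_one]
    have hσ0 : ∀ i, 0 ≤ σ i := fun i => Real.iSup_nonneg fun y => by
      split_ifs; exacts [(hA01 y).1, le_rfl]
    have hσmono : Monotone σ := fun i j hij => ciSup_mono (hbdd j) fun y => by
      split_ifs
      · exact le_rfl
      · omega
      · exact (hA01 y).1
      · exact le_rfl
    have hσlow : ∀ y, σ (c y) ≤ A y := fun y => ciSup_le fun z => by
      split_ifs with h
      · exact hA (le_of_lt (hcmono.reflect_lt h))
      · exact (hA01 y).1
    have hσup : ∀ y, A y ≤ σ (c y + 1) := fun y => by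
      have := le_ciSup (hbdd (c y + 1)) y
      rwa [if_pos (Nat.lt_succ_self _)] at this
    have hfl : ∀ i, ⌊σ i / η⌋₊ < R + 1 := fun i => by
      rw [Nat.floor_lt (div_nonneg (hσ0 i) hη.le), div_lt_iff₀ hη]
      push_cast
      linarith [hσ1 i]
    let t : Fin (m + 2) →o Fin (R + 1) :=
      ⟨fun i => ⟨⌊σ i / η⌋₊, hfl i⟩, fun i j hij => by
        simp only [Fin.mk_le_mk]
        exact Nat.floor_mono (div_le_div_of_nonneg_right (hσmono hij) hη.le)⟩
    refine ⟨t, fun y hy => ?_⟩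
    have hy : e t (c y) = e t (c y + 1) := by simpa using hy
    have he : ∀ i ≤ m + 1, e t i = ⌊σ i / η⌋₊ := fun i hi => by
      simp only [e, min_eq_left hi]; rfl
    have h1 := he (c y) ((hcle y).trans (Nat.le_succ _))
    have h2 := he (c y + 1) (Nat.succ_le_succ (hcle y))
    constructor
    · refine le_trans ?_ (hσlow y)
      have := Nat.floor_le (div_nonneg (hσ0 (c y)) hη.le)
      rw [le_div_iff₀ hη] at this
      change η * (e t (c y) : ℝ) ≤ _
      rw [h1]; linarith
    · refine (hσup y).trans ?_
      have := Nat.lt_floor_add_one (σ (c y + 1) / η)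
      rw [div_lt_iff₀ hη] at this
      change _ ≤ η * (e t (c y) : ℝ) + η
      rw [hy, h2]; linarith

lemma exists_multilevel_code (ν : Measure ℝ) [IsProbabilityMeasure ν] [NullSingletonClass ν]
    (q : ℝ) (η : ℕ → ℝ) (R m : ℕ → ℕ) (hm : ∀ k, 0 < m k) (hη : ∀ k, 0 < η k)
    (hR : ∀ k, 1 < η k * (R k + 1)) (n : ℕ) :
    ∀ k, R (k + n) = 0 →
    ∃ (T : Type) (_ : Finite T) (l w : T → ℝ → ℝ),
      Nat.card T ≤ ∏ j ∈ Finset.range (n + 1),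
        (R (k + j) + (m (k + j) + 2)).choose (R (k + j)) ∧
      (∀ t, Measurable (l t)) ∧ (∀ t, Measurable (w t)) ∧ (∀ t y, 0 ≤ w t y) ∧
      (∀ t E, MeasurableSet E → ∫⁻ y in E, ENNReal.ofReal (w t y ^ q) ∂ν ≤
        ENNReal.ofReal (η k ^ q) * ν E + ∑ j ∈ Finset.range n,
          ENNReal.ofReal (η (k + j + 1) ^ q) * ENNReal.ofReal (R (k + j) / m (k + j))) ∧
      ∀ A : ℝ → ℝ, Monotone A → (∀ y, A y ∈ Set.Icc (0 : ℝ) 1) →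
        ∃ t, ∀ y, l t y ≤ A y ∧ A y ≤ l t y + w t y := by
  classical
  induction n with
  | zero =>
    intro k hk
    obtain ⟨T, hT, bad, low, hcard, -, hlow, -, hbad, hA⟩ :=
      exists_level_code ν (hm k) (R k) (hη k) (hR k)
    refine ⟨T, hT, low, fun _ _ => η k, by simpa using hcard, hlow, fun _ => measurable_const,
      fun _ _ => (hη k).le, fun t E _ => by simp, fun A h1 h2 => ?_⟩
    obtain ⟨t, ht⟩ := hA A h1 h2
    exact ⟨t, fun y => ht y (by rw [hbad hk t]; simp)⟩
  | succ n ih =>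
    intro k hk
    obtain ⟨T, hT, bad, low, hcard, hbadm, hlow, hbad, -, hA⟩ :=
      exists_level_code ν (hm k) (R k) (hη k) (hR k)
    obtain ⟨T', hT', l, w, hcard', hl, hw, hw0, hint, hA'⟩ :=
      ih (k + 1) (by rw [← hk]; congr 1; ring)
    refine ⟨T × T', inferInstance, fun t => (bad t.1).piecewise (l t.2) (low t.1),
      fun t => (bad t.1).piecewise (w t.2) fun _ => η k, ?_,
      fun t => (hl t.2).piecewise (hbadm t.1) (hlow t.1),
      fun t => (hw t.2).piecewise (hbadm t.1) measurable_const, fun t y => ?_,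
      fun t E hE => ?_, fun A h1 h2 => ?_⟩
    · rw [Nat.card_prod, Finset.prod_range_succ', mul_comm]
      refine Nat.mul_le_mul (hcard'.trans_eq (Finset.prod_congr rfl fun j _ => ?_)) hcard
      rw [show k + 1 + j = k + (j + 1) by ring]
    · change 0 ≤ (bad t.1).piecewise (w t.2) (fun _ => η k) y
      by_cases hy : y ∈ bad t.1
      · rw [Set.piecewise_eq_of_mem _ _ _ hy]; exact hw0 _ _
      · rw [Set.piecewise_eq_of_notMem _ _ _ hy]; exact (hη k).le
    · have hpt : ∀ y, ENNReal.ofReal ((bad t.1).piecewise (w t.2) (fun _ => η k) y ^ q) ≤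
          ENNReal.ofReal (η k ^ q) +
            (bad t.1).indicator (fun y => ENNReal.ofReal (w t.2 y ^ q)) y := fun y => by
        by_cases hy : y ∈ bad t.1
        · rw [Set.piecewise_eq_of_mem _ _ _ hy, Set.indicator_of_mem hy]
          exact le_add_self
        · rw [Set.piecewise_eq_of_notMem _ _ _ hy]
          exact le_self_add
      have hb := hint t.2 (bad t.1) (hbadm _)
      calc ∫⁻ y in E, ENNReal.ofReal ((bad t.1).piecewise (w t.2) (fun _ => η k) y ^ q) ∂ν
          ≤ ∫⁻ y in E, (ENNReal.ofReal (η k ^ q) +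
            (bad t.1).indicator (fun y => ENNReal.ofReal (w t.2 y ^ q)) y) ∂ν :=
            lintegral_mono hpt
        _ = ENNReal.ofReal (η k ^ q) * ν E +
            ∫⁻ y in E, (bad t.1).indicator (fun y => ENNReal.ofReal (w t.2 y ^ q)) y ∂ν := by
            rw [lintegral_add_left measurable_const, setLIntegral_const]
        _ ≤ ENNReal.ofReal (η k ^ q) * ν E +
            ∫⁻ y in bad t.1, ENNReal.ofReal (w t.2 y ^ q) ∂ν := by
            rw [← lintegral_indicator (hbadm _)]
            refine add_le_add le_rfl ?_
            exact setLIntegral_le_lintegral _ _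
        _ ≤ _ := by
            gcongr
            rw [Finset.sum_range_succ', add_comm (Finset.sum _ _)]
            refine hb.trans (add_le_add ?_ (Finset.sum_le_sum fun j _ => ?_))
            · exact mul_le_mul_right (hbad t.1) _
            · rw [show k + 1 + j = k + (j + 1) by ring]
    · obtain ⟨t, ht⟩ := hA A h1 h2
      obtain ⟨t', ht'⟩ := hA' A h1 h2
      refine ⟨(t, t'), fun y => ?_⟩
      by_cases hy : y ∈ bad t
      · simpa [hy] using ht' y
      · simpa [hy] using ht y hy

lemma Nat.choose_le_exp_mul_pow (n R : ℕ) {x : ℝ} (hx : 0 < x) :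
    (n.choose R : ℝ) ≤ Real.exp (n * x) * x⁻¹ ^ R := by
  rcases lt_or_ge n R with h | h
  · rw [Nat.choose_eq_zero_of_lt h, Nat.cast_zero]; positivity
  have h1 : (n.choose R : ℝ) * x ^ R ≤ Real.exp (n * x) := by
    calc (n.choose R : ℝ) * x ^ R = x ^ R * 1 ^ (n - R) * (n.choose R : ℝ) := by ring
      _ ≤ ∑ i ∈ Finset.range (n + 1), x ^ i * 1 ^ (n - i) * (n.choose i : ℝ) :=
          Finset.single_le_sum (f := fun i => x ^ i * 1 ^ (n - i) * (n.choose i : ℝ))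
            (fun i _ => by positivity) (Finset.mem_range.2 (Nat.lt_succ_of_le h))
      _ = (x + 1) ^ n := (add_pow x 1 n).symm
      _ ≤ Real.exp x ^ n := by gcongr; exact Real.add_one_le_exp x
      _ = _ := by rw [← Real.exp_nat_mul]
  rw [inv_pow, ← div_eq_mul_inv, le_div_iff₀ (by positivity)]
  exact h1

lemma exists_monotone_code {q : ℝ} (hq : 1 ≤ q) :
    ∃ C > (0 : ℝ), ∀ (ν : Measure ℝ) [IsProbabilityMeasure ν] [NullSingletonClass ν],
      ∀ ε ∈ Set.Ioo (0 : ℝ) 1, ∃ (T : Type) (_ : Finite T) (l w : T → ℝ → ℝ),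
        (Nat.card T : ℝ) ≤ Real.exp (C / ε) ∧
        (∀ t, Measurable (l t)) ∧ (∀ t, Measurable (w t)) ∧ (∀ t y, 0 ≤ w t y) ∧
        (∀ t, ∫⁻ y, ENNReal.ofReal (w t y ^ q) ∂ν ≤ ENNReal.ofReal (C * ε ^ q)) ∧
        ∀ A : ℝ → ℝ, Monotone A → (∀ y, A y ∈ Set.Icc (0 : ℝ) 1) →
          ∃ t, ∀ y, l t y ≤ A y ∧ A y ≤ l t y + w t y := by
  have hq0 : 0 < q := by linarith
  obtain ⟨ρ, hρdef⟩ : ∃ ρ : ℝ, ρ = 2 ^ (1 / q) := ⟨_, rfl⟩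
  have hρ1 : 1 < ρ := hρdef ▸ Real.one_lt_rpow (by norm_num) (by positivity)
  have hρ0 : 0 < ρ := by linarith
  have hρq : ρ ^ q = 2 := by
    rw [hρdef, ← Real.rpow_mul (by norm_num), one_div_mul_cancel hq0.ne', Real.rpow_one]
  obtain ⟨r, hr⟩ : ∃ r : ℝ, r = ρ⁻¹ := ⟨_, rfl⟩
  have hr0 : 0 < r := hr ▸ inv_pos.2 hρ0
  have hr1 : r < 1 := hr ▸ inv_lt_one_of_one_lt₀ hρ1
  have hlog : 0 < Real.log 4 := Real.log_pos (by norm_num)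
  let a : ℕ → ℝ := fun k => 5 * (1 / 2) ^ k + (k * r ^ k) * Real.log 4
  have ha0 : ∀ k, 0 ≤ a k := fun k => by positivity
  have hasum : Summable a := by
    refine (summable_geometric_two.mul_left 5).add (Summable.mul_right _ ?_)
    simpa using summable_pow_mul_geometric_of_norm_lt_one 1
      (r := r) (by rw [Real.norm_eq_abs, abs_of_pos hr0]; exact hr1)
  have hrsum : Summable fun k : ℕ => r ^ k := summable_geometric_of_lt_one hr0.le hr1
  have hA0 : 0 ≤ ∑' k, a k := tsum_nonneg ha0
  have hB0 : 0 ≤ ∑' k, r ^ k := tsum_nonneg fun k => by positivity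
  refine ⟨(∑' k, a k) + (1 + 2 * ∑' k, r ^ k), by positivity, fun ν _ _ ε hε => ?_⟩
  obtain ⟨hε0, hε1⟩ := hε
  let η : ℕ → ℝ := fun k => ε * ρ ^ k
  let m : ℕ → ℕ := fun k => ⌈2 ^ k / ε⌉₊
  let R : ℕ → ℕ := fun k => ⌊1 / η k⌋₊
  have hη : ∀ k, 0 < η k := fun k => by positivity
  have hm : ∀ k, 0 < m k := fun k => Nat.ceil_pos.2 (by positivity)
  have hR : ∀ k, 1 < η k * (R k + 1) := fun k => by
    have := Nat.lt_floor_add_one (1 / η k)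
    rwa [div_lt_iff₀ (hη k), mul_comm] at this
  have hRle : ∀ k, (R k : ℝ) ≤ r ^ k / ε := fun k => by
    refine (Nat.floor_le (by positivity)).trans_eq ?_
    simp only [η, hr, inv_pow]
    field_simp
  have hmle : ∀ k, 2 ^ k / ε ≤ (m k : ℝ) := fun k => Nat.le_ceil _
  have hm' : ∀ k, (m k : ℝ) ≤ 2 ^ k / ε + 1 := fun k => (Nat.ceil_lt_add_one (by positivity)).le
  obtain ⟨K, hK⟩ : ∃ K, R K = 0 := by
    obtain ⟨K, hK⟩ := pow_unbounded_of_one_lt (1 / ε) hρ1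
    refine ⟨K, Nat.floor_eq_zero.2 ?_⟩
    rw [div_lt_one (hη K)]
    rwa [div_lt_iff₀ hε0, mul_comm] at hK
  obtain ⟨T, hT, l, w, hcard, hl, hw, hw0, hint, hcov⟩ :=
    exists_multilevel_code ν q η R m hm hη hR K 0 (by simpa using hK)
  refine ⟨T, hT, l, w, ?_, hl, hw, hw0, fun t => ?_, hcov⟩
  · have hlev : ∀ k, ((R k + (m k + 2)).choose (R k) : ℝ) ≤ Real.exp (a k / ε) := fun k => by
      refine (Nat.choose_le_exp_mul_pow _ _ (x := (1 / 4) ^ k) (by positivity)).trans ?_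
      have h2k : (1 : ℝ) ≤ 2 ^ k := one_le_pow₀ (by norm_num)
      have hrk : r ^ k ≤ 1 := pow_le_one₀ hr0.le hr1.le
      have h1 : 1 ≤ 2 ^ k / ε := by rw [le_div_iff₀ hε0]; linarith
      have h3 : r ^ k / ε ≤ 2 ^ k / ε := by gcongr; linarith
      have hn : ((R k + (m k + 2) : ℕ) : ℝ) ≤ 5 * (2 ^ k / ε) := by
        push_cast
        linarith [hRle k, hm' k]
      have h4 : (((1 / 4 : ℝ) ^ k)⁻¹) ^ R k = Real.exp (R k * (k * Real.log 4)) := by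
        rw [Real.exp_nat_mul, Real.exp_nat_mul, Real.exp_log (by norm_num)]
        simp
      rw [h4, ← Real.exp_add]
      refine Real.exp_le_exp.2 ?_
      have h5 : ((R k + (m k + 2) : ℕ) : ℝ) * (1 / 4) ^ k ≤ 5 * (1 / 2) ^ k / ε := by
        calc _ ≤ 5 * (2 ^ k / ε) * (1 / 4) ^ k := by gcongr
          _ = 5 * (2 * (1 / 4)) ^ k / ε := by rw [mul_pow]; ring
          _ = _ := by norm_num
      have h6 : (R k : ℝ) * (k * Real.log 4) ≤ r ^ k / ε * (k * Real.log 4) := by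
        gcongr; exact hRle k
      calc _ ≤ 5 * (1 / 2) ^ k / ε + r ^ k / ε * (k * Real.log 4) := add_le_add h5 h6
        _ = a k / ε := by simp only [a]; ring
    calc (Nat.card T : ℝ) ≤ ∏ j ∈ Finset.range (K + 1), ((R j + (m j + 2)).choose (R j) : ℝ) := by
          have := (Nat.cast_le (α := ℝ)).2 hcard
          simpa using this
      _ ≤ ∏ j ∈ Finset.range (K + 1), Real.exp (a j / ε) :=
          Finset.prod_le_prod (fun _ _ => by positivity) fun j _ => hlev j
      _ = Real.exp ((∑ j ∈ Finset.range (K + 1), a j) / ε) := by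
          rw [← Real.exp_sum, Finset.sum_div]
      _ ≤ _ := by
          refine Real.exp_le_exp.2 (div_le_div_of_nonneg_right ?_ hε0.le)
          linarith [hasum.sum_le_tsum (Finset.range (K + 1)) fun k _ => ha0 k]
  · have h := hint t Set.univ MeasurableSet.univ
    rw [Measure.restrict_univ, measure_univ, mul_one] at h
    have hηq : ∀ k, η k ^ q = ε ^ q * 2 ^ k := fun k => by
      simp only [η]
      rw [Real.mul_rpow hε0.le (by positivity), ← Real.rpow_natCast ρ, ← Real.rpow_mul hρ0.le,
        mul_comm (k : ℝ), Real.rpow_mul hρ0.le, hρq, Real.rpow_natCast]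
    have hεq : 0 < ε ^ q := Real.rpow_pos_of_pos hε0 q
    have hj : ∀ j, ENNReal.ofReal (η (0 + j + 1) ^ q) * ENNReal.ofReal (R (0 + j) / m (0 + j)) ≤
        ENNReal.ofReal (ε ^ q * (2 * r ^ j)) := fun j => by
      rw [zero_add, ← ENNReal.ofReal_mul (by positivity), hηq]
      refine ENNReal.ofReal_le_ofReal ?_
      have : (R j : ℝ) / m j ≤ (r ^ j / ε) / (2 ^ j / ε) := by
        gcongr
        · exact hRle j
        · exact hmle j
      calc ε ^ q * 2 ^ (j + 1) * (R j / m j)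
          ≤ ε ^ q * 2 ^ (j + 1) * ((r ^ j / ε) / (2 ^ j / ε)) := by gcongr
        _ = _ := by field_simp; ring
    refine h.trans ((add_le_add le_rfl (Finset.sum_le_sum fun j _ => hj j)).trans ?_)
    rw [← ENNReal.ofReal_sum_of_nonneg (fun j _ => by positivity),
      ← ENNReal.ofReal_add (by positivity) (Finset.sum_nonneg fun j _ => by positivity)]
    refine ENNReal.ofReal_le_ofReal ?_
    rw [hηq, ← Finset.mul_sum, ← Finset.mul_sum]
    have := hrsum.sum_le_tsum (Finset.range K) fun k _ => by positivity
    calc ε ^ q * 2 ^ 0 + ε ^ q * (2 * ∑ i ∈ Finset.range K, r ^ i)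
        = (1 + 2 * ∑ i ∈ Finset.range K, r ^ i) * ε ^ q := by ring
      _ ≤ _ := mul_le_mul_of_nonneg_right (by linarith) hεq.le

lemma lintegral_ofReal_add_rpow_le {α : Type*} [MeasurableSpace α] (μ : Measure α) {q : ℝ}
    (hq : 0 ≤ q) {f g : α → ℝ} (hf : ∀ x, 0 ≤ f x) (hg : ∀ x, 0 ≤ g x) (hfm : Measurable f) :
    ∫⁻ x, ENNReal.ofReal ((f x + g x) ^ q) ∂μ ≤ ENNReal.ofReal (2 ^ q) *
      (∫⁻ x, ENNReal.ofReal (f x ^ q) ∂μ + ∫⁻ x, ENNReal.ofReal (g x ^ q) ∂μ) := by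
  have hpt : ∀ x, ENNReal.ofReal ((f x + g x) ^ q) ≤
      ENNReal.ofReal (2 ^ q) * (ENNReal.ofReal (f x ^ q) + ENNReal.ofReal (g x ^ q)) := fun x => by
    have h1 := Real.rpow_nonneg (hf x) q
    have h2 := Real.rpow_nonneg (hg x) q
    rw [← ENNReal.ofReal_add h1 h2, ← ENNReal.ofReal_mul (by positivity)]
    refine ENNReal.ofReal_le_ofReal ?_
    have h2q : (0 : ℝ) ≤ 2 ^ q := by positivity
    rcases le_total (f x) (g x) with h | h
    · calc (f x + g x) ^ q ≤ (2 * g x) ^ q :=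
            Real.rpow_le_rpow (add_nonneg (hf x) (hg x)) (by linarith) hq
        _ = 2 ^ q * g x ^ q := Real.mul_rpow (by norm_num) (hg x)
        _ ≤ _ := mul_le_mul_of_nonneg_left (by linarith) h2q
    · calc (f x + g x) ^ q ≤ (2 * f x) ^ q :=
            Real.rpow_le_rpow (add_nonneg (hf x) (hg x)) (by linarith) hq
        _ = 2 ^ q * f x ^ q := Real.mul_rpow (by norm_num) (hf x)
        _ ≤ _ := mul_le_mul_of_nonneg_left (by linarith) h2q
  have hfm' : Measurable fun x => ENNReal.ofReal (f x ^ q) := (hfm.pow_const q).ennreal_ofReal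
  calc _ ≤ ∫⁻ x, ENNReal.ofReal (2 ^ q) *
        (ENNReal.ofReal (f x ^ q) + ENNReal.ofReal (g x ^ q)) ∂μ := lintegral_mono hpt
    _ = _ := by rw [lintegral_const_mul' _ _ ENNReal.ofReal_ne_top, lintegral_add_left hfm']

lemma Monotone.lintegral_shift_sub_le {F : ℝ → ℝ} (hF : Monotone F)
    (h01 : ∀ y, F y ∈ Set.Icc (0 : ℝ) 1) {δ : ℝ} (hδ : 0 ≤ δ) :
    ∫⁻ y, ENNReal.ofReal (F (y + δ) - F (y - δ)) ≤ ENNReal.ofReal (2 * δ) := by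
  have hi : ∀ a b, IntervalIntegrable F volume a b := fun a b => hF.intervalIntegrable
  have hp : Monotone fun y => F (y + δ) := fun x y h => hF (by linarith)
  have hn : Monotone fun y => F (y - δ) := fun x y h => hF (by linarith)
  have hnonneg : ∀ y, 0 ≤ F (y + δ) - F (y - δ) := fun y => sub_nonneg.2 (hF (by linarith))
  have hint : ∀ a b, IntervalIntegrable (fun y => F (y + δ) - F (y - δ)) volume a b :=
    fun a b => hp.intervalIntegrable.sub hn.intervalIntegrable
  have hbound : ∀ n : ℕ, ∫ y in (-(n : ℝ))..n, (F (y + δ) - F (y - δ)) ≤ 2 * δ := fun n => by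
    rw [intervalIntegral.integral_sub hp.intervalIntegrable hn.intervalIntegrable,
      intervalIntegral.integral_comp_add_right F, intervalIntegral.integral_comp_sub_right F]
    have h1 := intervalIntegral.integral_add_adjacent_intervals
      (hi (-(n : ℝ) - δ) (-n + δ)) (hi (-n + δ) (n + δ))
    have h2 := intervalIntegral.integral_add_adjacent_intervals
      (hi (-(n : ℝ) - δ) (n - δ)) (hi (n - δ) (n + δ))
    have h3 : ∫ y in ((n : ℝ) - δ)..(n + δ), F y ≤ ∫ _ in ((n : ℝ) - δ)..(n + δ), (1 : ℝ) :=
      intervalIntegral.integral_mono_on (by linarith) (hi _ _) (by simp) fun y _ => (h01 y).2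
    have h4 : 0 ≤ ∫ y in (-(n : ℝ) - δ)..(-n + δ), F y :=
      intervalIntegral.integral_nonneg (by linarith) fun y _ => (h01 y).1
    rw [intervalIntegral.integral_const, smul_eq_mul, mul_one] at h3
    linarith
  have hnorm : ∀ y, ‖F (y + δ) - F (y - δ)‖ = F (y + δ) - F (y - δ) := fun y =>
    Real.norm_of_nonneg (hnonneg y)
  have ha : Filter.Tendsto (fun n : ℕ => -(n : ℝ)) Filter.atTop Filter.atBot :=
    Filter.tendsto_neg_atTop_atBot.comp tendsto_natCast_atTop_atTop
  have hI : Integrable fun y => F (y + δ) - F (y - δ) :=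
    integrable_of_intervalIntegral_norm_bounded (2 * δ)
      (fun n : ℕ => (hint (-(n : ℝ)) n).1) ha tendsto_natCast_atTop_atTop
      (Filter.Eventually.of_forall fun n => by simpa only [hnorm] using hbound n)
  rw [← ofReal_integral_eq_lintegral_ofReal hI (Filter.Eventually.of_forall hnonneg)]
  refine ENNReal.ofReal_le_ofReal (_root_.le_of_tendsto
    (intervalIntegral_tendsto_integral hI ha tendsto_natCast_atTop_atTop)
    (Filter.Eventually.of_forall hbound))

lemma exists_monotone_sub_of_eVariationOn_le {f : ℝ → ℝ} {M : ℝ} (hM : 0 < M)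
    (hf : ∀ t, f t ∈ Set.Icc (-M) M) (hv : eVariationOn f Set.univ ≤ ENNReal.ofReal M) :
    ∃ V W : ℝ → ℝ, Monotone V ∧ Monotone W ∧ (∀ y, V y ∈ Set.Icc (0 : ℝ) 1) ∧
      (∀ y, W y ∈ Set.Icc (0 : ℝ) 1) ∧ ∀ y, f y = 4 * M * (V y - W y) := by
  have hbv : LocallyBoundedVariationOn f Set.univ :=
    BoundedVariationOn.locallyBoundedVariationOn (ne_top_of_le_ne_top ENNReal.ofReal_ne_top hv)
  let v := variationOnFromTo f Set.univ 0
  have hv1 : Monotone v := monotoneOn_univ.1 (variationOnFromTo.monotoneOn hbv (Set.mem_univ 0))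
  have hv2 : Monotone (v - f) :=
    monotoneOn_univ.1 (variationOnFromTo.sub_self_monotoneOn hbv (Set.mem_univ 0))
  have hvar : ∀ s, (eVariationOn f (Set.univ ∩ s)).toReal ≤ M := fun s => by
    refine ENNReal.toReal_le_of_le_ofReal hM.le (le_trans (eVariationOn.mono f ?_) hv)
    exact Set.inter_subset_left
  have hvM : ∀ y, -M ≤ v y ∧ v y ≤ M := fun y => by
    simp only [v, variationOnFromTo]
    split_ifs
    · exact ⟨by linarith [(ENNReal.toReal_nonneg : 0 ≤ (eVariationOn f (Set.univ ∩ Set.Icc 0 y)).toReal)],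
        hvar _⟩
    · exact ⟨neg_le_neg (hvar _),
        by linarith [(ENNReal.toReal_nonneg : 0 ≤ (eVariationOn f (Set.univ ∩ Set.Icc y 0)).toReal)]⟩
  have h4 : 0 < 4 * M := by positivity
  refine ⟨fun y => (v y + 2 * M) / (4 * M), fun y => ((v - f) y + 2 * M) / (4 * M),
    fun x y h => ?_, fun x y h => ?_, fun y => ?_, fun y => ?_, fun y => ?_⟩
  · exact div_le_div_of_nonneg_right (by linarith [hv1 h]) h4.le
  · exact div_le_div_of_nonneg_right (by linarith [hv2 h]) h4.le
  · have := hvM y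
    exact ⟨div_nonneg (by linarith) h4.le, (div_le_one h4).2 (by linarith)⟩
  · have := hvM y
    have := hf y
    simp only [Pi.sub_apply, Set.mem_Icc] at *
    exact ⟨div_nonneg (by linarith) h4.le, (div_le_one h4).2 (by linarith)⟩
  · simp only [Pi.sub_apply]
    field_simp
    ring

lemma exists_perturbed_monotone_code {q M : ℝ} (hq : 1 ≤ q) (hM : 0 < M) :
    ∃ C > (0 : ℝ), ∀ (ν : Measure ℝ) [IsProbabilityMeasure ν],
      (∀ A : Set ℝ, MeasurableSet A → ν A ≤ ENNReal.ofReal M * volume A) →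
      ∀ ε ∈ Set.Ioo (0 : ℝ) 1, ∃ (T : Type) (_ : Finite T) (g d : T → ℝ → ℝ),
        (Nat.card T : ℝ) ≤ Real.exp (C / ε) ∧ (∀ t, Measurable (d t)) ∧
        ∀ F : ℝ → ℝ, Monotone F → (∀ y, F y ∈ Set.Icc (0 : ℝ) 1) → ∃ t,
          (∀ y z, |z - y| ≤ 2 * ε ^ q → |F z - g t y| ≤ d t y) ∧
          (∀ y, 0 ≤ d t y) ∧
          ∫⁻ y, ENNReal.ofReal (d t y ^ q) ∂ν ≤ ENNReal.ofReal (C * ε ^ q) := by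
  have hq0 : 0 < q := by linarith
  obtain ⟨C, hC, hcode⟩ := exists_monotone_code hq
  have h2q : (0 : ℝ) < 2 ^ q := by positivity
  refine ⟨2 * C + 2 ^ q * (4 * M + 2 ^ q * (2 * C)), by positivity, fun ν _ hν ε hε => ?_⟩
  have : NullSingletonClass ν := ⟨fun x => by simpa using hν {x} (measurableSet_singleton x)⟩
  obtain ⟨T, hT, l, w, hcard, hl, hw, hw0, hint, hcov⟩ := hcode ν ε hε
  obtain ⟨hε0, hε1⟩ := hε
  have hεq : 0 < ε ^ q := Real.rpow_pos_of_pos hε0 q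
  refine ⟨T × T, inferInstance, fun t => l t.1, fun t y => l t.2 y + w t.2 y - l t.1 y, ?_,
    fun t => ((hl t.2).add (hw t.2)).sub (hl t.1), fun F hF h01 => ?_⟩
  · rw [Nat.card_prod, Nat.cast_mul]
    calc (Nat.card T : ℝ) * Nat.card T ≤ Real.exp (C / ε) * Real.exp (C / ε) := by gcongr
      _ = Real.exp (2 * C / ε) := by rw [← Real.exp_add]; congr 1; ring
      _ ≤ _ := by
        refine Real.exp_le_exp.2 (div_le_div_of_nonneg_right ?_ hε0.le)
        linarith [show 0 < 2 ^ q * (4 * M + 2 ^ q * (2 * C)) by positivity]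
  obtain ⟨δ, hδ⟩ : ∃ δ, δ = 2 * ε ^ q := ⟨_, rfl⟩
  have hδ0 : 0 < δ := by rw [hδ]; positivity
  have hB : Monotone fun y => F (y + δ) := fun x y h => hF (by linarith)
  have hA : Monotone fun y => F (y - δ) := fun x y h => hF (by linarith)
  obtain ⟨t₁, ht₁⟩ := hcov _ hA fun y => h01 _
  obtain ⟨t₂, ht₂⟩ := hcov _ hB fun y => h01 _
  have hAB : ∀ y, 0 ≤ F (y + δ) - F (y - δ) := fun y => sub_nonneg.2 (hF (by linarith))
  have hd0 : ∀ y, 0 ≤ l t₂ y + w t₂ y - l t₁ y := fun y => by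
    linarith [(ht₁ y).1, (ht₂ y).2, hAB y]
  refine ⟨(t₁, t₂), fun y z hyz => ?_, hd0, ?_⟩
  · rw [← hδ, abs_le] at hyz
    have h1 : F (y - δ) ≤ F z := hF (by linarith)
    have h2 : F z ≤ F (y + δ) := hF (by linarith)
    rw [abs_of_nonneg (by linarith [(ht₁ y).1])]
    linarith [(ht₂ y).2]
  · have hsum := lintegral_ofReal_add_rpow_le ν hq0.le (hw0 t₁) (hw0 t₂) (hw t₁)
    have hsum' := lintegral_ofReal_add_rpow_le ν hq0.le hAB
      (fun y => add_nonneg (hw0 t₁ y) (hw0 t₂ y)) (hB.measurable.sub hA.measurable)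
    have hshift : ∫⁻ y, ENNReal.ofReal ((F (y + δ) - F (y - δ)) ^ q) ∂ν ≤
        ENNReal.ofReal (4 * M * ε ^ q) := by
      calc ∫⁻ y, ENNReal.ofReal ((F (y + δ) - F (y - δ)) ^ q) ∂ν
          ≤ ∫⁻ y, ENNReal.ofReal (F (y + δ) - F (y - δ)) ∂ν := by
            refine lintegral_mono fun y => ENNReal.ofReal_le_ofReal ?_
            have h1 : F (y + δ) - F (y - δ) ≤ 1 := by linarith [(h01 (y + δ)).2, (h01 (y - δ)).1]
            exact Real.rpow_le_self_of_le_one (hAB y) h1 hq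
        _ ≤ ∫⁻ y, ENNReal.ofReal (F (y + δ) - F (y - δ)) ∂(ENNReal.ofReal M • volume) :=
            lintegral_mono' (Measure.le_iff.2 fun A hA => by simpa using hν A hA) le_rfl
        _ = ENNReal.ofReal M * ∫⁻ y, ENNReal.ofReal (F (y + δ) - F (y - δ)) := by
            rw [lintegral_smul_measure, smul_eq_mul]
        _ ≤ ENNReal.ofReal M * ENNReal.ofReal (2 * δ) := by
            gcongr
            exact hF.lintegral_shift_sub_le h01 hδ0.le
        _ = _ := by rw [← ENNReal.ofReal_mul hM.le, hδ]; congr 1; ring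
    calc ∫⁻ y, ENNReal.ofReal ((l t₂ y + w t₂ y - l t₁ y) ^ q) ∂ν
        ≤ ∫⁻ y, ENNReal.ofReal (((F (y + δ) - F (y - δ)) + (w t₁ y + w t₂ y)) ^ q) ∂ν := by
          refine lintegral_mono fun y => ENNReal.ofReal_le_ofReal
            (Real.rpow_le_rpow (hd0 y) ?_ hq0.le)
          linarith [(ht₁ y).2, (ht₂ y).1]
      _ ≤ _ := hsum'
      _ ≤ ENNReal.ofReal (2 ^ q) * (ENNReal.ofReal (4 * M * ε ^ q) + ENNReal.ofReal (2 ^ q) *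
            (ENNReal.ofReal (C * ε ^ q) + ENNReal.ofReal (C * ε ^ q))) := by
          gcongr
          exact hsum.trans (by gcongr <;> exact hint _)
      _ = ENNReal.ofReal (2 ^ q * (4 * M + 2 ^ q * (2 * C)) * ε ^ q) := by
          rw [← ENNReal.ofReal_add (by positivity) (by positivity),
            ← ENNReal.ofReal_mul (by positivity),
            ← ENNReal.ofReal_add (by positivity) (by positivity),
            ← ENNReal.ofReal_mul (by positivity)]
          congr 1; ring
      _ ≤ _ := by
          refine ENNReal.ofReal_le_ofReal (mul_le_mul_of_nonneg_right ?_ hεq.le)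
          linarith

/-- Bracketing of the functions `f ∘ l`, with `f` of bounded variation and `l` uniformly close to a
fixed function `l₀` whose law has a bounded density. -/
lemma exists_boundedVariation_brackets {q M : ℝ} (hq : 1 ≤ q) (hM : 0 < M) :
    ∃ C₁ > (0 : ℝ), ∃ C₂ > (0 : ℝ), ∀ (S : Type) [MeasurableSpace S] (μ : Measure S)
      [IsProbabilityMeasure μ] (l₀ : S → ℝ), Measurable l₀ →
      (∀ A : Set ℝ, MeasurableSet A → μ.map l₀ A ≤ ENNReal.ofReal M * volume A) →
      ∀ ε ∈ Set.Ioo (0 : ℝ) 1, ∃ g Δ : Fin ⌈Real.exp (C₁ / ε)⌉₊ → S → ℝ,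
        (∀ j, Measurable (Δ j)) ∧
        ∀ f : ℝ → ℝ, (∀ t, f t ∈ Set.Icc (-M) M) →
          eVariationOn f Set.univ ≤ ENNReal.ofReal M →
          ∀ l : S → ℝ, (∀ s, |l s - l₀ s| ≤ 2 * ε ^ q) → ∃ j,
            (∀ s, |f (l s) - g j s| ≤ Δ j s) ∧ Integrable (fun s => Δ j s ^ q) μ ∧
            (∫ s, Δ j s ^ q ∂μ) ^ (1 / q) ≤ C₂ * ε := by
  classical
  have hq0 : 0 < q := by linarith
  obtain ⟨C, hC, hcode⟩ := exists_perturbed_monotone_code hq hM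
  refine ⟨2 * C, by positivity, ((4 * M) ^ q * (2 ^ q * (2 * C))) ^ (1 / q), by positivity,
    fun S _ μ _ l₀ hl₀ hdens ε hε => ?_⟩
  have : IsProbabilityMeasure (μ.map l₀) := Measure.isProbabilityMeasure_map hl₀.aemeasurable
  obtain ⟨T, hT, g, d, hcard, hd, hcov⟩ := hcode (μ.map l₀) hdens ε hε
  obtain ⟨hε0, hε1⟩ := hε
  have hεq : 0 < ε ^ q := Real.rpow_pos_of_pos hε0 q
  have hcard2 : Nat.card (T × T) ≤ Nat.card (Fin ⌈Real.exp (2 * C / ε)⌉₊) := by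
    rw [Nat.card_fin, Nat.card_prod]
    have h : ((Nat.card T * Nat.card T : ℕ) : ℝ) ≤ Real.exp (2 * C / ε) := by
      rw [Nat.cast_mul]
      calc (Nat.card T : ℝ) * Nat.card T ≤ Real.exp (C / ε) * Real.exp (C / ε) := by gcongr
        _ = _ := by rw [← Real.exp_add]; congr 1; ring
    exact_mod_cast h.trans (Nat.le_ceil _)
  obtain ⟨e⟩ : Nonempty (T × T ↪ Fin ⌈Real.exp (2 * C / ε)⌉₊) := by
    have := Fintype.ofFinite T
    refine Function.Embedding.nonempty_of_card_le ?_
    rwa [← Nat.card_eq_fintype_card, ← Nat.card_eq_fintype_card]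
  let g' : T × T → S → ℝ := fun t s => 4 * M * (g t.1 (l₀ s) - g t.2 (l₀ s))
  let d' : T × T → S → ℝ := fun t s => 4 * M * (d t.1 (l₀ s) + d t.2 (l₀ s))
  have hd' : ∀ t, Measurable (d' t) := fun t =>
    (((hd t.1).comp hl₀).add ((hd t.2).comp hl₀)).const_mul _
  refine ⟨Function.extend e g' 0, Function.extend e d' 0, fun j => ?_, fun f hf hv l hl => ?_⟩
  · by_cases hj : ∃ t, e t = j
    · obtain ⟨t, rfl⟩ := hj
      rw [e.injective.extend_apply]; exact hd' t
    · rw [Function.extend_apply' _ _ _ hj]; exact measurable_zero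
  obtain ⟨V, W, hV, hW, hV01, hW01, hVW⟩ := exists_monotone_sub_of_eVariationOn_le hM hf hv
  obtain ⟨t₁, h₁, h₁0, h₁i⟩ := hcov V hV hV01
  obtain ⟨t₂, h₂, h₂0, h₂i⟩ := hcov W hW hW01
  refine ⟨e (t₁, t₂), ?_⟩
  rw [e.injective.extend_apply, e.injective.extend_apply]
  have h4 : 0 < 4 * M := by positivity
  have hnn : ∀ s, 0 ≤ d' (t₁, t₂) s := fun s =>
    mul_nonneg h4.le (add_nonneg (h₁0 _) (h₂0 _))
  have hnnq : ∀ s, 0 ≤ d' (t₁, t₂) s ^ q := fun s => Real.rpow_nonneg (hnn s) q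
  have hmeas : Measurable fun s => d' (t₁, t₂) s ^ q := (hd' _).pow_const q
  have hlint : ∫⁻ s, ENNReal.ofReal (d' (t₁, t₂) s ^ q) ∂μ ≤
      ENNReal.ofReal ((4 * M) ^ q * (2 ^ q * (2 * C)) * ε ^ q) := by
    have hm₁ : Measurable fun y => ENNReal.ofReal (d t₁ y ^ q) :=
      ((hd t₁).pow_const q).ennreal_ofReal
    have hm₂ : Measurable fun y => ENNReal.ofReal (d t₂ y ^ q) :=
      ((hd t₂).pow_const q).ennreal_ofReal
    rw [lintegral_map hm₁ hl₀] at h₁i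
    rw [lintegral_map hm₂ hl₀] at h₂i
    calc ∫⁻ s, ENNReal.ofReal (d' (t₁, t₂) s ^ q) ∂μ
        = ∫⁻ s, ENNReal.ofReal ((4 * M) ^ q) *
            ENNReal.ofReal ((d t₁ (l₀ s) + d t₂ (l₀ s)) ^ q) ∂μ := by
          refine lintegral_congr fun s => ?_
          rw [← ENNReal.ofReal_mul (by positivity),
            ← Real.mul_rpow h4.le (add_nonneg (h₁0 _) (h₂0 _))]
      _ = ENNReal.ofReal ((4 * M) ^ q) *
            ∫⁻ s, ENNReal.ofReal ((d t₁ (l₀ s) + d t₂ (l₀ s)) ^ q) ∂μ :=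
          lintegral_const_mul' _ _ ENNReal.ofReal_ne_top
      _ ≤ ENNReal.ofReal ((4 * M) ^ q) * (ENNReal.ofReal (2 ^ q) *
            (ENNReal.ofReal (C * ε ^ q) + ENNReal.ofReal (C * ε ^ q))) := by
          gcongr
          exact (lintegral_ofReal_add_rpow_le μ hq0.le (fun s => h₁0 (l₀ s)) (fun s => h₂0 (l₀ s))
            ((hd t₁).comp hl₀)).trans (by gcongr)
      _ = _ := by
          rw [← ENNReal.ofReal_add (by positivity) (by positivity),
            ← ENNReal.ofReal_mul (by positivity), ← ENNReal.ofReal_mul (by positivity)]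
          congr 1; ring
  have hI : Integrable (fun s => d' (t₁, t₂) s ^ q) μ := by
    refine ⟨hmeas.aestronglyMeasurable, ?_⟩
    rw [hasFiniteIntegral_iff_ofReal (Filter.Eventually.of_forall hnnq)]
    exact hlint.trans_lt ENNReal.ofReal_lt_top
  refine ⟨fun s => ?_, hI, ?_⟩
  · have a₁ := h₁ (l₀ s) (l s) (hl s)
    have a₂ := h₂ (l₀ s) (l s) (hl s)
    rw [hVW, ← mul_sub, abs_mul, abs_of_pos h4]
    refine mul_le_mul_of_nonneg_left ?_ h4.le
    rw [abs_le] at *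
    constructor <;> linarith
  · rw [← ofReal_integral_eq_lintegral_ofReal hI (Filter.Eventually.of_forall hnnq),
      ENNReal.ofReal_le_ofReal_iff (by positivity)] at hlint
    calc (∫ s, d' (t₁, t₂) s ^ q ∂μ) ^ (1 / q)
        ≤ ((4 * M) ^ q * (2 ^ q * (2 * C)) * ε ^ q) ^ (1 / q) :=
          Real.rpow_le_rpow (integral_nonneg hnnq) hlint (by positivity)
      _ = _ := by
          rw [Real.mul_rpow (by positivity) hεq.le, ← Real.rpow_mul hε0.le,
            mul_one_div_cancel hq0.ne', Real.rpow_one]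

/-- Corollary A1 of the paper: a bracketing bound in `L_q(μ)` for the class
`𝓑_n = {s ↦ β_u(n⁻¹ Σ_j 1{λ(x_j) ≤ λ(s)}) : u ∈ [0,1], λ ∈ Λ, x ∈ Sⁿ}`, where each
`β_u` is a `[−M,M]`-valued function of bounded variation (≤ M) and each `λ ∈ Λ` has
pushforward density bounded by `M`.  The constants depend only on `q` and `M`. -/
theorem stmt8 (q M : ℝ) (hq : 1 ≤ q) (hM : 0 < M) :
    ∃ C₁ > (0:ℝ), ∃ C₂ > (0:ℝ),
      ∀ (S : Type) [MeasurableSpace S] (μ : Measure S) [IsProbabilityMeasure μ]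
        (Λ : Set (S → ℝ)) (β : ℝ → ℝ → ℝ),
        (∀ l ∈ Λ, Measurable l ∧
          ∀ A : Set ℝ, MeasurableSet A → μ.map l A ≤ ENNReal.ofReal M * volume A) →
        (∀ u ∈ Set.Icc (0:ℝ) 1, (∀ t, β u t ∈ Set.Icc (-M) M) ∧
          eVariationOn (β u) Set.univ ≤ ENNReal.ofReal M) →
        ∀ (n : ℕ), ∀ ε ∈ Set.Ioo (0:ℝ) 1,
        ∀ (N : ℕ) (Λ₀ : Fin N → S → ℝ),
          (∀ l ∈ Λ, ∃ i, ∀ s, |l s - Λ₀ i s| ≤ ε ^ q) →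
          ∃ g Δ : Fin (N * ⌈Real.exp (C₁ / ε)⌉₊) → S → ℝ,
            (∀ j, Measurable (Δ j)) ∧
            ∀ u ∈ Set.Icc (0:ℝ) 1, ∀ l ∈ Λ, ∀ x : Fin n → S, ∃ j,
              (∀ s, |β u ((n : ℝ)⁻¹ *
                  ∑ j' : Fin n, if l (x j') ≤ l s then (1:ℝ) else 0) - g j s|
                ≤ Δ j s) ∧
              Integrable (fun s => Δ j s ^ q) μ ∧
              (∫ s, Δ j s ^ q ∂μ) ^ (1/q) ≤ C₂ * ε := by
  classical
  obtain ⟨C₁, hC₁, C₂, hC₂, hbr⟩ := exists_boundedVariation_brackets hq hM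
  refine ⟨C₁, hC₁, C₂, hC₂, fun S _ μ _ Λ β hΛ hβ n ε hε N Λ₀ hΛ₀ => ?_⟩
  have key : ∀ i : Fin N, ∃ g Δ : Fin ⌈Real.exp (C₁ / ε)⌉₊ → S → ℝ, (∀ j, Measurable (Δ j)) ∧
      ∀ f : ℝ → ℝ, (∀ t, f t ∈ Set.Icc (-M) M) → eVariationOn f Set.univ ≤ ENNReal.ofReal M →
        ∀ l ∈ Λ, (∀ s, |l s - Λ₀ i s| ≤ ε ^ q) → ∃ j,
          (∀ s, |f (l s) - g j s| ≤ Δ j s) ∧ Integrable (fun s => Δ j s ^ q) μ ∧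
          (∫ s, Δ j s ^ q ∂μ) ^ (1 / q) ≤ C₂ * ε := fun i => by
    by_cases h : ∃ l₀ ∈ Λ, ∀ s, |l₀ s - Λ₀ i s| ≤ ε ^ q
    · obtain ⟨l₀, hl₀, hclose⟩ := h
      obtain ⟨g, Δ, hΔ, hcov⟩ := hbr S μ l₀ (hΛ l₀ hl₀).1 (hΛ l₀ hl₀).2 ε hε
      refine ⟨g, Δ, hΔ, fun f hf hv l _ hl => hcov f hf hv l fun s => ?_⟩
      have h1 := hl s
      have h2 := hclose s
      rw [abs_le] at *
      constructor <;> linarith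
    · exact ⟨0, 0, fun _ => measurable_zero, fun f _ _ l hlΛ hl => (h ⟨l, hlΛ, hl⟩).elim⟩
  choose g Δ hΔ hcov using key
  refine ⟨fun j => g (finProdFinEquiv.symm j).1 (finProdFinEquiv.symm j).2,
    fun j => Δ (finProdFinEquiv.symm j).1 (finProdFinEquiv.symm j).2, fun j => hΔ _ _,
    fun u hu l hl x => ?_⟩
  obtain ⟨i, hi⟩ := hΛ₀ l hl
  let F : ℝ → ℝ := fun y => (n : ℝ)⁻¹ * ∑ j' : Fin n, if l (x j') ≤ y then (1 : ℝ) else 0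
  have hF : Monotone F := fun y z hyz => by
    refine mul_le_mul_of_nonneg_left (Finset.sum_le_sum fun j _ => ?_) (by positivity)
    split_ifs with h1 h2
    · exact le_rfl
    · exact absurd (h1.trans hyz) h2
    · exact zero_le_one
    · exact le_rfl
  obtain ⟨j, hj⟩ := hcov i (β u ∘ F) (fun t => (hβ u hu).1 _)
    ((eVariationOn.comp_le_of_monotoneOn _ _ (hF.monotoneOn _) (Set.mapsTo_univ _ _)).trans
      (hβ u hu).2) l hl hi
  refine ⟨finProdFinEquiv (i, j), ?_⟩
  simp only [Equiv.symm_apply_apply]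
  exact hj
end
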